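/- arXiv:2310.03459 — 4 statements merged into one kernel-verified Lean document; each statement's English description precedes it below -/
import Mathlib

section
/- Let L_S = ∏_{p ∈ S_f} L_p, where L_p = p for odd primes p and L_2 = 2³ = 8 (with L_S = 1 if S_f = ∅). For every m₀ ∈ ℕ with gcd(m₀, L_S) = 1 there exists a constant C > 0, depending only on L_S, such that for all real N ≥ 2: | ∑_{m ∈ ℕ, 1 ≤ m ≤ N, m ≡ m₀ (mod L_S)} φ(m) − N²/(2·L_S·ζ_S(2)) | ≤ C·N·log N, where φ is Euler's totient function. -/
open MeasureTheory Matrix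

noncomputable section

noncomputable instance Padic.instMeasurableSpace' {p : ℕ} [Fact p.Prime] :
    MeasurableSpace ℚ_[p] := borel _

instance Padic.instBorelSpace' {p : ℕ} [Fact p.Prime] : BorelSpace ℚ_[p] := ⟨rfl⟩

instance Matrix.SpecialLinearGroup.instTopologicalSpace'
    {n : Type*} [DecidableEq n] [Fintype n] {R : Type*} [CommRing R] [TopologicalSpace R] :
    TopologicalSpace (SpecialLinearGroup n R) :=
  show TopologicalSpace {A : Matrix n n R // A.det = 1} from inferInstance

noncomputable instance Matrix.SpecialLinearGroup.instMeasurableSpace'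
    {n : Type*} [DecidableEq n] [Fintype n] {R : Type*} [CommRing R] [TopologicalSpace R] :
    MeasurableSpace (SpecialLinearGroup n R) := borel _

/-- A finite set of distinct primes `p 0, …, p (s-1)`. -/
structure PrimeTup where
  s : ℕ
  p : Fin s → ℕ
  hp : ∀ i, (p i).Prime
  inj : Function.Injective p

namespace PrimeTup

instance (S : PrimeTup) (i : Fin S.s) : Fact (S.p i).Prime := ⟨S.hp i⟩

/-- The `p i`-adic field. -/
abbrev Qp (S : PrimeTup) (i : Fin S.s) : Type := ℚ_[S.p i]

/-- The space `ℚ_S^d = ℝ^d × ∏ᵢ ℚ_{pᵢ}^d`. -/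
abbrev QS (S : PrimeTup) (d : ℕ) : Type :=
  (Fin d → ℝ) × ((i : Fin S.s) → Fin d → S.Qp i)

/-- The ring `ℤ_S = ℤ[1/p₁, …, 1/p_s] ⊆ ℚ`. -/
def Zs (S : PrimeTup) : Subring ℚ :=
  Subring.closure (Set.range fun i : Fin S.s => ((S.p i : ℚ))⁻¹)

/-- The group `G_d = SL_d(ℝ) × ∏ᵢ SL_d(ℚ_{pᵢ})`. -/
abbrev G (S : PrimeTup) (d : ℕ) : Type :=
  SpecialLinearGroup (Fin d) ℝ × ((i : Fin S.s) → SpecialLinearGroup (Fin d) (S.Qp i))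

/-- Diagonal embedding of `SL_d(ℤ_S)` into `G_d`. -/
def toG (S : PrimeTup) (d : ℕ) : SpecialLinearGroup (Fin d) S.Zs →* S.G d :=
  MonoidHom.prod
    (SpecialLinearGroup.map ((Rat.castHom ℝ).comp S.Zs.subtype))
    (Pi.monoidHom fun i => SpecialLinearGroup.map ((Rat.castHom (S.Qp i)).comp S.Zs.subtype))

/-- The lattice `Γ_d`, the diagonally embedded copy of `SL_d(ℤ_S)` in `G_d`. -/
def Gamma (S : PrimeTup) (d : ℕ) : Subgroup (S.G d) := (S.toG d).range

/-- The componentwise linear action of `G_d` on `ℚ_S^d`. -/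
def act (S : PrimeTup) {d : ℕ} (g : S.G d) (x : S.QS d) : S.QS d :=
  ((g.1 : Matrix (Fin d) (Fin d) ℝ).mulVec x.1,
   fun i => ((g.2 i : Matrix (Fin d) (Fin d) (S.Qp i))).mulVec (x.2 i))

/-- Diagonal embedding of rational vectors into `ℚ_S^d`. -/
def diag (S : PrimeTup) {d : ℕ} (v : Fin d → ℚ) : S.QS d :=
  (fun j => (v j : ℝ), fun i j => (v j : S.Qp i))

/-- The first standard basis vector of `ℤ_S^d`. -/
def e1 (S : PrimeTup) (d : ℕ) : Fin d → S.Zs := fun j => if j.1 = 0 then 1 else 0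

/-- The set of `S`-primitive vectors `P(ℤ_S^d) = SL_d(ℤ_S)·e₁` inside `(ℤ_S)^d`. -/
def primZs (S : PrimeTup) (d : ℕ) : Set (Fin d → S.Zs) :=
  {w | ∃ γ : SpecialLinearGroup (Fin d) S.Zs,
    w = (γ : Matrix (Fin d) (Fin d) S.Zs).mulVec (S.e1 d)}

/-- The set of `S`-primitive vectors regarded inside `ℚ_S^d` via the diagonal embedding. -/
def prim (S : PrimeTup) (d : ℕ) : Set (S.QS d) :=
  (fun w : Fin d → S.Zs => S.diag fun j => ((w j : ℚ))) '' S.primZs d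

/-- Multiplication of a vector of `ℚ_S^d` by a (diagonally embedded) rational scalar. -/
def ratSMul (S : PrimeTup) {d : ℕ} (q : ℚ) (x : S.QS d) : S.QS d :=
  (fun j => (q : ℝ) * x.1 j, fun i j => (q : S.Qp i) * x.2 i j)

/-- `ℕ_S`: positive integers coprime to all the primes of `S`. -/
def NS (S : PrimeTup) : Set ℕ := {m | 0 < m ∧ ∀ i, ¬ (S.p i ∣ m)}

/-- The `S`-arithmetic zeta value `ζ_S(d)`. -/
def zetaS (S : PrimeTup) (d : ℕ) : ℝ := ∑' m : S.NS, (1 : ℝ) / ((m : ℕ) : ℝ) ^ d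

/-- The "unit box" `[0,1]^d × ∏ᵢ ℤ_{pᵢ}^d` used to normalize the volume on `ℚ_S^d`. -/
def unitBox (S : PrimeTup) (d : ℕ) : Set (S.QS d) :=
  {x | (∀ j, x.1 j ∈ Set.Icc (0:ℝ) 1) ∧ ∀ i j, ‖x.2 i j‖ ≤ 1}

/-- `v` is the measure `vol_S` on `ℚ_S^d`: the (unique) translation-invariant regular Borel
measure giving the unit box `[0,1]^d × ∏ᵢ ℤ_{pᵢ}^d` measure one; equivalently, the product of
Lebesgue measure on `ℝ^d` and the normalized Haar measures on the `ℚ_{pᵢ}^d`. -/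
def IsVolS (S : PrimeTup) (d : ℕ) (v : Measure (S.QS d)) : Prop :=
  v.IsAddHaarMeasure ∧ v.Regular ∧ v (S.unitBox d) = 1

/-- `μ` is an admissible measure on `G_d/Γ_d`: a regular Borel probability measure invariant
under the left `G_d`-action. -/
def Admissible (S : PrimeTup) (d : ℕ) (μ : Measure (S.G d ⧸ S.Gamma d)) : Prop :=
  IsProbabilityMeasure μ ∧ μ.Regular ∧ SMulInvariantMeasure (S.G d) (S.G d ⧸ S.Gamma d) μ

end PrimeTup

end

namespace PrimeTup

/-- `L_S = ∏_{p ∈ S_f} L_p` with `L_p = p` for odd `p` and `L_2 = 8`. -/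
def LS (S : PrimeTup) : ℕ := ∏ i, (if S.p i = 2 then 8 else S.p i)

end PrimeTup

open scoped ArithmeticFunction.Moebius

theorem sum_Icc_sum_divisorsAntidiagonal {M : Type*} [AddCommMonoid M] (F : ℕ → ℕ → M) (n : ℕ) :
    ∑ m ∈ Finset.Icc 1 n, ∑ x ∈ m.divisorsAntidiagonal, F x.1 x.2 =
      ∑ a ∈ Finset.Icc 1 n, ∑ b ∈ Finset.Icc 1 (n / a), F a b := by
  rw [Finset.sum_sigma', Finset.sum_sigma']
  refine Finset.sum_bij' (fun x _ => ⟨x.2.1, x.2.2⟩) (fun y _ => ⟨y.1 * y.2, (y.1, y.2)⟩)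
    ?_ ?_ ?_ ?_ ?_
  · rintro ⟨m, a, b⟩ h
    simp only [Finset.mem_sigma, Finset.mem_Icc, Nat.mem_divisorsAntidiagonal] at h ⊢
    obtain ⟨⟨_, h2⟩, rfl, h4⟩ := h
    have ha : 0 < a := Nat.pos_of_ne_zero (left_ne_zero_of_mul h4)
    have hb : 0 < b := Nat.pos_of_ne_zero (right_ne_zero_of_mul h4)
    refine ⟨⟨ha, le_trans (Nat.le_mul_of_pos_right a hb) h2⟩, hb, ?_⟩
    rw [Nat.le_div_iff_mul_le ha, mul_comm]
    exact h2
  · rintro ⟨a, b⟩ h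
    simp only [Finset.mem_sigma, Finset.mem_Icc, Nat.mem_divisorsAntidiagonal] at h ⊢
    obtain ⟨⟨ha, _⟩, hb, h4⟩ := h
    rw [Nat.le_div_iff_mul_le ha, mul_comm] at h4
    have := Nat.mul_pos ha hb
    exact ⟨⟨this, h4⟩, trivial, this.ne'⟩
  · rintro ⟨m, a, b⟩ h
    simp only [Finset.mem_sigma, Nat.mem_divisorsAntidiagonal] at h
    obtain ⟨_, rfl, _⟩ := h
    rfl
  · rintro ⟨a, b⟩ _
    rfl
  · rintro ⟨m, a, b⟩ _
    rfl

theorem totient_eq_sum_moebius_mul {n : ℕ} (hn : 0 < n) :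
    (n.totient : ℝ) = ∑ x ∈ n.divisorsAntidiagonal, (μ x.1 : ℝ) * x.2 :=
  ((ArithmeticFunction.sum_eq_iff_sum_mul_moebius_eq (R := ℝ)
    (f := fun i => (i.totient : ℝ)) (g := fun i => (i : ℝ))).1
    (fun n _ => by exact_mod_cast n.sum_totient) n hn).symm

theorem sum_totient_filter_mod_eq (L m₀ n : ℕ) :
    ∑ m ∈ (Finset.Icc 1 n).filter (fun m => m % L = m₀ % L), (m.totient : ℝ) =
      ∑ a ∈ Finset.Icc 1 n,
        (μ a : ℝ) * ∑ b ∈ (Finset.Icc 1 (n / a)).filter (fun b => a * b % L = m₀ % L), (b : ℝ) := by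
  rw [Finset.sum_filter]
  have := sum_Icc_sum_divisorsAntidiagonal
    (fun a b => if a * b % L = m₀ % L then (μ a : ℝ) * b else 0) n
  simp only [← Finset.sum_filter, ← Finset.mul_sum] at this
  rw [← this]
  refine Finset.sum_congr rfl fun m hm => ?_
  rw [Finset.sum_filter]
  split_ifs with h
  · rw [totient_eq_sum_moebius_mul (Finset.mem_Icc.1 hm).1]
    refine Finset.sum_congr rfl fun x hx => ?_
    rw [if_pos (by rw [(Nat.mem_divisorsAntidiagonal.1 hx).1, h])]
  · refine (Finset.sum_eq_zero fun x hx => ?_).symm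
    rw [if_neg (by rwa [(Nat.mem_divisorsAntidiagonal.1 hx).1])]

/-- Every window of `L` consecutive integers contains exactly one element of each residue class. -/
theorem exists_filter_Ioc_mod_eq_singleton {L : ℕ} (hL : 0 < L) (c n : ℕ) :
    ∃ d, n < d ∧ d ≤ n + L ∧
      (Finset.Ioc n (n + L)).filter (fun b => b % L = c % L) = {d} := by
  have h := Nat.filter_Ico_card_eq_of_periodic (n + 1) L (fun b => b % L = c % L)
    (fun b => by simp)
  have hI : Finset.Ico (n + 1) (n + 1 + L) = Finset.Ioc n (n + L) := by
    ext b
    simp only [Finset.mem_Ico, Finset.mem_Ioc]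
    omega
  have h1 : Nat.count (fun b => b % L = c % L) L = 1 := by
    rw [Nat.count_eq_card_filter_range, Finset.card_eq_one]
    refine ⟨c % L, ?_⟩
    ext b
    simp only [Finset.mem_filter, Finset.mem_range, Finset.mem_singleton]
    constructor
    · rintro ⟨hb, h⟩
      rwa [Nat.mod_eq_of_lt hb] at h
    · rintro rfl
      exact ⟨Nat.mod_lt _ hL, Nat.mod_mod _ _⟩
  rw [h1, hI, Finset.card_eq_one] at h
  obtain ⟨d, hd⟩ := h
  have hm : d ∈ (Finset.Ioc n (n + L)).filter (fun b => b % L = c % L) := by simp [hd]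
  rw [Finset.mem_filter, Finset.mem_Ioc] at hm
  exact ⟨d, hm.1.1, hm.1.2, hd⟩

theorem abs_sum_filter_mod_eq_sub_le {L : ℕ} (hL : 0 < L) (c n : ℕ) :
    |∑ b ∈ (Finset.Icc 1 n).filter (fun b => b % L = c % L), (b : ℝ) - (n : ℝ) ^ 2 / (2 * L)|
      ≤ (n : ℝ) := by
  have hL' : (0 : ℝ) < L := by exact_mod_cast hL
  induction n using Nat.strong_induction_on with
  | _ n ih =>
  rcases lt_or_ge n L with hn | hn
  · have hnL : (n : ℝ) ≤ L := by exact_mod_cast hn.le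
    have hn0 : (0 : ℝ) ≤ n := n.cast_nonneg
    have hq : (n : ℝ) ^ 2 / (2 * L) ≤ n := by
      rw [div_le_iff₀ (by positivity)]
      nlinarith
    have hq0 : 0 ≤ (n : ℝ) ^ 2 / (2 * L) := by positivity
    have hs0 : 0 ≤ ∑ b ∈ (Finset.Icc 1 n).filter (fun b => b % L = c % L), (b : ℝ) :=
      Finset.sum_nonneg fun b _ => b.cast_nonneg
    have hs : ∑ b ∈ (Finset.Icc 1 n).filter (fun b => b % L = c % L), (b : ℝ) ≤ n := by
      by_cases hc : c % L ∈ Finset.Icc 1 n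
      · have : (Finset.Icc 1 n).filter (fun b => b % L = c % L) ⊆ {c % L} := by
          intro b hb
          rw [Finset.mem_filter, Finset.mem_Icc] at hb
          rw [Finset.mem_singleton, ← hb.2, Nat.mod_eq_of_lt (by omega)]
        refine (Finset.sum_le_sum_of_subset_of_nonneg this fun b _ _ => b.cast_nonneg).trans ?_
        rw [Finset.sum_singleton]
        exact_mod_cast (Finset.mem_Icc.1 hc).2
      · rw [Finset.filter_eq_empty_iff.2, Finset.sum_empty]
        · exact hn0
        · intro b hb h
          apply hc
          rw [← h, Nat.mod_eq_of_lt (by rw [Finset.mem_Icc] at hb; omega)]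
          exact hb
    rw [abs_le]
    constructor <;> linarith
  · obtain ⟨k, rfl⟩ := Nat.exists_eq_add_of_le' hn
    have := ih k (by omega)
    obtain ⟨d, hd1, hd2, hd⟩ := exists_filter_Ioc_mod_eq_singleton hL c k
    have hsplit : ∑ b ∈ (Finset.Icc 1 (k + L)).filter (fun b => b % L = c % L), (b : ℝ) =
        ∑ b ∈ (Finset.Icc 1 k).filter (fun b => b % L = c % L), (b : ℝ) + d := by
      rw [← Finset.sum_singleton (fun b : ℕ => (b : ℝ)) d, ← hd, ← Finset.sum_union,
        ← Finset.filter_union]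
      · congr 2
        ext b
        simp only [Finset.mem_union, Finset.mem_Icc, Finset.mem_Ioc]
        omega
      · refine Finset.disjoint_filter_filter ?_
        rw [Finset.disjoint_left]
        intro b
        simp only [Finset.mem_Icc, Finset.mem_Ioc]
        omega
    have hd1' : (k : ℝ) ≤ d := by exact_mod_cast hd1.le
    have hd2' : (d : ℝ) ≤ k + L := by exact_mod_cast hd2
    have hsq : ((k : ℝ) + L) ^ 2 / (2 * L) = (k : ℝ) ^ 2 / (2 * L) + k + L / 2 := by
      field_simp
      ring
    rw [hsplit]
    push_cast
    rw [hsq]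
    rw [abs_le] at this ⊢
    constructor <;> linarith [this.1, this.2]

theorem abs_sum_filter_mod_eq_floor_sub_le {L : ℕ} (hL : 0 < L) (c : ℕ) {x : ℝ} (hx : 0 ≤ x) :
    |∑ b ∈ (Finset.Icc 1 ⌊x⌋₊).filter (fun b => b % L = c % L), (b : ℝ) - x ^ 2 / (2 * L)|
      ≤ 2 * x := by
  have h := abs_sum_filter_mod_eq_sub_le hL c ⌊x⌋₊
  have hL' : (1 : ℝ) ≤ L := by exact_mod_cast hL
  have h1 := Nat.floor_le hx
  have h2 := (Nat.lt_floor_add_one x).le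
  have h0 : (0 : ℝ) ≤ ⌊x⌋₊ := Nat.cast_nonneg _
  have h3 : x ^ 2 / (2 * L) - (⌊x⌋₊ : ℝ) ^ 2 / (2 * L) ≤ x := by
    rw [← sub_div, div_le_iff₀ (by positivity)]
    nlinarith
  have h4 : (⌊x⌋₊ : ℝ) ^ 2 / (2 * L) ≤ x ^ 2 / (2 * L) := by gcongr
  rw [abs_le] at h ⊢
  constructor <;> linarith [h.1, h.2]

theorem abs_sum_filter_mul_mod_eq_sub_le {L m₀ : ℕ} (hL : 0 < L) (hm : m₀.Coprime L) (a : ℕ)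
    {x : ℝ} (hx : 0 ≤ x) :
    |∑ b ∈ (Finset.Icc 1 ⌊x⌋₊).filter (fun b => a * b % L = m₀ % L), (b : ℝ)
      - if a.Coprime L then x ^ 2 / (2 * L) else 0| ≤ 2 * x := by
  split_ifs with ha
  · obtain ⟨a', -, ha'⟩ := Nat.exists_mul_mod_eq_of_coprime m₀ ha hL.ne'
    have : ∀ b, a * b % L = m₀ % L ↔ b % L = a' % L := by
      intro b
      rw [← ha']
      exact ⟨fun h => Nat.ModEq.cancel_left_of_coprime (m := L) (c := a)
        (by rwa [Nat.coprime_comm] at ha) h, fun h => Nat.ModEq.mul_left a h⟩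
    simp only [this]
    exact abs_sum_filter_mod_eq_floor_sub_le hL a' hx
  · rw [Finset.filter_eq_empty_iff.2]
    · simpa using hx
    · intro b _ h
      apply ha
      have h' : (a * b).gcd L = m₀.gcd L := Nat.ModEq.gcd_eq h
      exact Nat.Coprime.coprime_mul_right (k := b) (h'.trans hm)

theorem abs_moebius_div_sq_le {L : ℕ} (n : ℕ) :
    |if n.Coprime L then (μ n : ℝ) / (n : ℝ) ^ 2 else 0| ≤ ((n : ℝ) ^ 2)⁻¹ := by
  split_ifs
  · rw [abs_div, abs_of_nonneg (by positivity : (0 : ℝ) ≤ (n : ℝ) ^ 2), div_eq_mul_inv]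
    have : |(μ n : ℝ)| ≤ 1 := by exact_mod_cast ArithmeticFunction.abs_moebius_le_one
    exact mul_le_of_le_one_left (by positivity) this
  · simp only [abs_zero]
    positivity

theorem summable_moebius_div_sq (L : ℕ) :
    Summable fun n : ℕ => if n.Coprime L then (μ n : ℝ) / (n : ℝ) ^ 2 else 0 :=
  .of_norm_bounded (Real.summable_nat_pow_inv.2 one_lt_two) fun n => abs_moebius_div_sq_le n

theorem abs_sum_moebius_div_sq_sub_tsum_le (L n : ℕ) :
    |∑ a ∈ Finset.Icc 1 n, (if a.Coprime L then (μ a : ℝ) / (a : ℝ) ^ 2 else 0)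
      - ∑' a : ℕ, if a.Coprime L then (μ a : ℝ) / (a : ℝ) ^ 2 else 0| ≤ 2 / (n + 1) := by
  have hlim := (summable_moebius_div_sq L).hasSum.tendsto_sum_nat
  have hlim' := (tendsto_const_nhds (x := ∑ a ∈ Finset.Icc 1 n,
    (if a.Coprime L then (μ a : ℝ) / (a : ℝ) ^ 2 else 0))).sub hlim |>.abs
  refine le_of_tendsto hlim' ?_
  filter_upwards [Filter.eventually_gt_atTop n] with K hK
  have : ∑ a ∈ Finset.range K, (if a.Coprime L then (μ a : ℝ) / (a : ℝ) ^ 2 else 0) =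
      ∑ a ∈ Finset.Icc 1 n, (if a.Coprime L then (μ a : ℝ) / (a : ℝ) ^ 2 else 0) +
      ∑ a ∈ Finset.Ioo n K, (if a.Coprime L then (μ a : ℝ) / (a : ℝ) ^ 2 else 0) := by
    rw [← Finset.sum_union]
    · refine (Finset.sum_subset ?_ ?_).symm
      · intro a
        simp only [Finset.mem_union, Finset.mem_Icc, Finset.mem_Ioo, Finset.mem_range]
        omega
      · intro a ha ha'
        simp only [Finset.mem_union, Finset.mem_Icc, Finset.mem_Ioo, Finset.mem_range] at ha ha'
        obtain rfl : a = 0 := by omega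
        simp
    · rw [Finset.disjoint_left]
      intro a
      simp only [Finset.mem_Icc, Finset.mem_Ioo]
      omega
  rw [this, sub_add_cancel_left, abs_neg]
  exact (Finset.abs_sum_le_sum_abs _ _).trans
    ((Finset.sum_le_sum fun a _ => abs_moebius_div_sq_le a).trans (sum_Ioo_inv_sq_le n K))

theorem tsum_coprime_mul_tsum_moebius (L : ℕ) :
    (∑' n : ℕ, if n.Coprime L then 1 / (n : ℝ) ^ 2 else 0) *
      (∑' n : ℕ, if n.Coprime L then (μ n : ℝ) / (n : ℝ) ^ 2 else 0) = 1 := by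
  have h := DirichletCharacter.LSeries.mul_mu_eq_one (N := L) 1 (s := 2) (by norm_num)
  have hχ : ∀ n : ℕ, (1 : DirichletCharacter ℂ L) n = if n.Coprime L then 1 else 0 := by
    intro n
    split_ifs with h
    · exact MulChar.one_apply ((ZMod.isUnit_iff_coprime n L).2 h)
    · exact MulChar.map_nonunit _ fun h' => h ((ZMod.isUnit_iff_coprime n L).1 h')
  rw [← Complex.ofReal_inj]
  push_cast
  rw [← h]
  simp only [LSeries]
  congr 1 <;>
  · refine tsum_congr fun n => ?_
    rw [LSeries.term_def]
    rcases eq_or_ne n 0 with rfl | hn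
    · simp
    · simp only [hn, if_false, Pi.mul_apply, hχ]
      split_ifs <;> simp

theorem abs_sum_totient_filter_mod_eq_sub_le {L m₀ : ℕ} (hL : 0 < L) (hm : m₀.Coprime L)
    {N : ℝ} (hN : 2 ≤ N) :
    |∑ m ∈ (Finset.Icc 1 ⌊N⌋₊).filter (fun m => m % L = m₀ % L), (m.totient : ℝ) -
      N ^ 2 / (2 * L) * ∑' n : ℕ, if n.Coprime L then (μ n : ℝ) / (n : ℝ) ^ 2 else 0|
      ≤ 8 * N * Real.log N := by
  set M := ∑' n : ℕ, if n.Coprime L then (μ n : ℝ) / (n : ℝ) ^ 2 else 0 with hM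
  have hN0 : 0 < N := by linarith
  have hL' : (1 : ℝ) ≤ L := by exact_mod_cast hL
  have hmain : |∑ m ∈ (Finset.Icc 1 ⌊N⌋₊).filter (fun m => m % L = m₀ % L), (m.totient : ℝ) -
      N ^ 2 / (2 * L) * ∑ a ∈ Finset.Icc 1 ⌊N⌋₊,
        (if a.Coprime L then (μ a : ℝ) / (a : ℝ) ^ 2 else 0)| ≤ 2 * N * (1 + Real.log N) := by
    rw [sum_totient_filter_mod_eq, Finset.mul_sum, ← Finset.sum_sub_distrib]
    have hb : ∀ a ∈ Finset.Icc 1 ⌊N⌋₊, |(μ a : ℝ) *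
        ∑ b ∈ (Finset.Icc 1 (⌊N⌋₊ / a)).filter (fun b => a * b % L = m₀ % L), (b : ℝ) -
        N ^ 2 / (2 * L) * (if a.Coprime L then (μ a : ℝ) / (a : ℝ) ^ 2 else 0)|
        ≤ 2 * N * (a : ℝ)⁻¹ := by
      intro a _
      have h := abs_sum_filter_mul_mod_eq_sub_le hL hm a (x := N / a) (by positivity)
      rw [Nat.floor_div_natCast] at h
      have hμ : |(μ a : ℝ)| ≤ 1 := by exact_mod_cast ArithmeticFunction.abs_moebius_le_one
      have he : N ^ 2 / (2 * L) * (if a.Coprime L then (μ a : ℝ) / (a : ℝ) ^ 2 else 0) =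
          (μ a : ℝ) * (if a.Coprime L then (N / a) ^ 2 / (2 * L) else 0) := by
        split_ifs
        · ring
        · simp
      rw [he, ← mul_sub, abs_mul]
      calc _ ≤ 1 * (2 * (N / a)) := mul_le_mul hμ h (abs_nonneg _) zero_le_one
        _ = _ := by ring
    refine (Finset.abs_sum_le_sum_abs _ _).trans ((Finset.sum_le_sum hb).trans ?_)
    rw [← Finset.mul_sum]
    have hh := harmonic_floor_le_one_add_log N (by linarith)
    rw [harmonic_eq_sum_Icc] at hh
    push_cast at hh
    gcongr
  have htail := abs_sum_moebius_div_sq_sub_tsum_le L ⌊N⌋₊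
  rw [← hM] at htail
  have htail' : |N ^ 2 / (2 * L) * ∑ a ∈ Finset.Icc 1 ⌊N⌋₊,
      (if a.Coprime L then (μ a : ℝ) / (a : ℝ) ^ 2 else 0) - N ^ 2 / (2 * L) * M| ≤ N := by
    rw [← mul_sub, abs_mul, abs_of_nonneg (by positivity)]
    calc _ ≤ N ^ 2 / (2 * 1) * (2 / N) := by
          refine mul_le_mul (by gcongr) (htail.trans ?_) (abs_nonneg _) (by positivity)
          have := (Nat.lt_floor_add_one N).le
          gcongr
      _ = N := by field_simp
  have hlog : 1 / 2 ≤ Real.log N := by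
    have := Real.log_le_log two_pos hN
    linarith [Real.log_two_gt_d9]
  refine (abs_sub_le _ _ _).trans ((add_le_add hmain htail').trans ?_)
  nlinarith

namespace PrimeTup

theorem LS_pos (S : PrimeTup) : 0 < S.LS := by
  refine Finset.prod_pos fun i _ => ?_
  split_ifs
  · norm_num
  · exact (S.hp i).pos

theorem coprime_LS_iff (S : PrimeTup) (m : ℕ) : m.Coprime S.LS ↔ ∀ i, ¬ S.p i ∣ m := by
  rw [LS, Nat.coprime_prod_right_iff]
  simp only [Finset.mem_univ, true_imp_iff]
  refine forall_congr' fun i => ?_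
  rw [← (S.hp i).coprime_iff_not_dvd, Nat.coprime_comm]
  split_ifs with h
  · rw [h, show 8 = 2 ^ 3 by norm_num, Nat.coprime_pow_left_iff (by norm_num)]
  · rfl

theorem zetaS_eq_tsum_coprime (S : PrimeTup) :
    S.zetaS 2 = ∑' n : ℕ, if n.Coprime S.LS then 1 / (n : ℝ) ^ 2 else 0 := by
  rw [zetaS, tsum_subtype S.NS (fun n : ℕ => (1 : ℝ) / (n : ℝ) ^ 2)]
  refine tsum_congr fun n => ?_
  rcases eq_or_ne n 0 with rfl | hn
  · simp [Set.indicator]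
  · simp only [Set.indicator, NS, Set.mem_ofPred_eq, Nat.pos_of_ne_zero hn, true_and,
      coprime_LS_iff]

end PrimeTup

open PrimeTup in
/-- **Euler-totient summatory function in congruence classes** (Lemma 4.2).
There is `C > 0`, depending only on `L_S`, such that for every `m₀` coprime to `L_S`
and all real `N ≥ 2`,
`|∑_{1 ≤ m ≤ N, m ≡ m₀ (mod L_S)} φ(m) − N²/(2 L_S ζ_S(2))| ≤ C N log N`. -/
theorem totient_sum_congruence_asymptotic (S : PrimeTup) :
    ∃ C : ℝ, 0 < C ∧
      ∀ m₀ : ℕ, Nat.gcd m₀ S.LS = 1 →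
        ∀ N : ℝ, 2 ≤ N →
          |(∑ m ∈ (Finset.Icc 1 ⌊N⌋₊).filter (fun m => m % S.LS = m₀ % S.LS),
              (Nat.totient m : ℝ)) -
            N ^ 2 / (2 * (S.LS : ℝ) * S.zetaS 2)| ≤ C * N * Real.log N := by
  refine ⟨8, by norm_num, fun m₀ hm N hN => ?_⟩
  have hz := tsum_coprime_mul_tsum_moebius S.LS
  rw [← S.zetaS_eq_tsum_coprime] at hz
  have h := abs_sum_totient_filter_mod_eq_sub_le S.LS_pos hm hN
  rwa [eq_inv_of_mul_eq_one_right hz, ← div_eq_mul_inv, div_div] at h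
end

section
/- Let 0 ≤ r₀ < r₁ ≤ ∞ and let χ : ℝ → [0, ∞) be a function vanishing outside [r₀, r₁], non-increasing on [r₀, r₁], and with ∫_{r₀}^{r₁} χ(t) dt < ∞. Then for every Borel set A ⊆ ℝ²: ∫_{ℝ²} ∫_{ℝ²} χ(|x₁y₂ − x₂y₁|)·1_A(x)·1_A(y) dx dy ≤ 8·λ(A)·[ r₀·χ(r₀) + ∫_{r₀}^{r₁} χ(t) dt ], where λ denotes Lebesgue measure on ℝ², x = (x₁, x₂), y = (y₁, y₂), and the integration is with respect to Lebesgue measure on ℝ² in each variable. -/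
open MeasureTheory ENNReal

/-- The measure `|r| dr`, the radial part of Lebesgue measure on the plane in the coordinates
`(r, m) ↦ (r, r * m)`. -/
noncomputable def radialMeasure : Measure ℝ :=
  volume.withDensity fun r => ENNReal.ofReal |r|

instance : SFinite radialMeasure := by
  unfold radialMeasure; infer_instance

/-- The symmetric interval `[-√a, √a]`, which has radial measure `a`. -/
def radialInterval (a : ℝ≥0∞) : Set ℝ := {r | ENNReal.ofReal (r ^ 2) ≤ a}

theorem measurableSet_radialInterval (a : ℝ≥0∞) : MeasurableSet (radialInterval a) :=
  measurableSet_le (by fun_prop) measurable_const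

theorem measurable_radialInterval_indicator :
    Measurable fun p : ℝ≥0∞ × ℝ => (radialInterval p.1).indicator (1 : ℝ → ℝ≥0∞) p.2 := by
  have h : MeasurableSet {p : ℝ≥0∞ × ℝ | ENNReal.ofReal (p.2 ^ 2) ≤ p.1} :=
    measurableSet_le (by fun_prop) measurable_fst
  exact (measurable_one (α := ℝ≥0∞)).indicator h

theorem lintegral_radialMeasure {f : ℝ → ℝ≥0∞} (hf : Measurable f) :
    ∫⁻ r, f r ∂radialMeasure = ∫⁻ r, ENNReal.ofReal |r| * f r := by
  unfold radialMeasure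
  rw [lintegral_withDensity_eq_lintegral_mul _ (by fun_prop) hf]
  rfl

theorem radialInterval_ofReal_sq {t : ℝ} (ht : 0 ≤ t) :
    radialInterval (ENNReal.ofReal (t ^ 2)) = Set.Icc (-t) t := by
  ext r
  simp only [radialInterval, Set.mem_ofPred_eq, Set.mem_Icc]
  rw [ENNReal.ofReal_le_ofReal_iff (by positivity), sq_le_sq, abs_of_nonneg ht, abs_le]

theorem radialMeasure_Icc {t : ℝ} (ht : 0 ≤ t) :
    radialMeasure (Set.Icc (-t) t) = ENNReal.ofReal (t ^ 2) := by
  unfold radialMeasure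
  rw [withDensity_apply _ measurableSet_Icc,
    ← ofReal_integral_eq_lintegral_ofReal (continuous_abs.integrableOn_Icc)
      (Filter.Eventually.of_forall fun _ => abs_nonneg _),
    integral_Icc_eq_integral_Ioc, ← intervalIntegral.integral_of_le (by linarith),
    ← intervalIntegral.integral_add_adjacent_intervals (b := 0)
      (continuous_abs.intervalIntegrable _ _) (continuous_abs.intervalIntegrable _ _)]
  have h₁ : ∫ x in (-t)..0, |x| = ∫ x in (-t)..0, -x :=
    intervalIntegral.integral_congr fun x hx => by
      rw [Set.uIcc_of_le (by linarith)] at hx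
      exact abs_of_nonpos hx.2
  have h₂ : ∫ x in (0 : ℝ)..t, |x| = ∫ x in (0 : ℝ)..t, x :=
    intervalIntegral.integral_congr fun x hx => by
      rw [Set.uIcc_of_le ht] at hx
      exact abs_of_nonneg hx.1
  rw [h₁, h₂, intervalIntegral.integral_neg, integral_id, integral_id]
  congr 1
  ring

theorem le_radialMeasure_radialInterval (a : ℝ≥0∞) :
    a ≤ radialMeasure (radialInterval a) := by
  refine ENNReal.le_of_forall_nnreal_lt fun b hb => ?_
  have hb' : (b : ℝ≥0∞) = ENNReal.ofReal (Real.sqrt b ^ 2) := by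
    rw [Real.sq_sqrt b.coe_nonneg, ENNReal.ofReal_coe_nnreal]
  calc (b : ℝ≥0∞) = radialMeasure (radialInterval b) := by
        rw [hb', radialInterval_ofReal_sq (Real.sqrt_nonneg _),
          radialMeasure_Icc (Real.sqrt_nonneg _)]
    _ ≤ _ := measure_mono fun r (hr : _ ≤ _) => hr.trans hb.le

theorem volume_radialInterval_sq_le (a : ℝ≥0∞) :
    volume (radialInterval a) * volume (radialInterval a) ≤ 4 * a := by
  rcases eq_or_ne a ⊤ with rfl | ha
  · simp
  · lift a to NNReal using ha
    have ha' : (a : ℝ≥0∞) = ENNReal.ofReal (Real.sqrt a ^ 2) := by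
      rw [Real.sq_sqrt a.coe_nonneg, ENNReal.ofReal_coe_nnreal]
    rw [ha', radialInterval_ofReal_sq (Real.sqrt_nonneg _), Real.volume_Icc,
      ← ENNReal.ofReal_mul (by have := Real.sqrt_nonneg a; linarith),
      show (4 : ℝ≥0∞) = ENNReal.ofReal 4 by norm_num, ← ENNReal.ofReal_mul (by norm_num)]
    exact ENNReal.ofReal_le_ofReal (by nlinarith)

/-- Among sets of given radial measure, the centered interval meets a balanced set the most. -/
theorem radialMeasure_inter_le (E : Set ℝ) {S : Set ℝ}
    (hS : ∀ t ∈ S, ∀ t', |t'| ≤ |t| → t' ∈ S) :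
    radialMeasure (E ∩ S) ≤ radialMeasure (radialInterval (radialMeasure E) ∩ S) := by
  by_cases h : radialInterval (radialMeasure E) ⊆ S
  · rw [Set.inter_eq_left.2 h]
    exact (measure_mono Set.inter_subset_left).trans (le_radialMeasure_radialInterval _)
  · obtain ⟨t, ht, htS⟩ := Set.not_subset.1 h
    refine measure_mono fun s hs => ⟨?_, hs.2⟩
    have hst : |s| ≤ |t| := le_of_not_ge fun hts => htS (hS s hs.2 t hts)
    exact (ENNReal.ofReal_le_ofReal (sq_le_sq.2 hst)).trans ht

theorem measurable_indicator_one {α : Type*} [MeasurableSpace α] {s : Set α}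
    (hs : MeasurableSet s) : Measurable (s.indicator (1 : α → ℝ≥0∞)) :=
  measurable_one.indicator hs

section Kernel

variable {K : Set ℝ}

theorem lintegral_indicator_mul_le (hK : MeasurableSet K)
    (hbal : ∀ t ∈ K, ∀ t', |t'| ≤ |t| → t' ∈ K) {E : Set ℝ} (hE : MeasurableSet E) (q : ℝ) :
    ∫⁻ r, E.indicator 1 r * K.indicator (1 : ℝ → ℝ≥0∞) (r * q) ∂radialMeasure ≤
      ∫⁻ r, (radialInterval (radialMeasure E)).indicator 1 r *
        K.indicator (1 : ℝ → ℝ≥0∞) (r * q) ∂radialMeasure := by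
  have hS : MeasurableSet ((fun r => r * q) ⁻¹' K) := hK.preimage (by fun_prop)
  have key : ∀ F : Set ℝ, MeasurableSet F →
      ∫⁻ r, F.indicator 1 r * K.indicator (1 : ℝ → ℝ≥0∞) (r * q) ∂radialMeasure =
        radialMeasure (F ∩ (fun r => r * q) ⁻¹' K) := by
    intro F hF
    rw [← lintegral_indicator_one (hF.inter hS)]
    simp_rw [Set.inter_indicator_one]
    rfl
  rw [key E hE, key _ (measurableSet_radialInterval _)]
  refine radialMeasure_inter_le E fun t ht t' htt' => hbal _ ht _ ?_
  simp only [abs_mul]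
  gcongr

/-- The integral over two radial intervals of the determinant kernel, where `d` is the difference
of the slopes. -/
noncomputable def radialPairing (K : Set ℝ) (a b : ℝ≥0∞) (d : ℝ) : ℝ≥0∞ :=
  ∫⁻ r, ∫⁻ s, (radialInterval a).indicator 1 r * (radialInterval b).indicator 1 s *
    K.indicator 1 (r * s * d) ∂radialMeasure ∂radialMeasure

theorem measurable_radialPairing (hK : MeasurableSet K) :
    Measurable fun p : (ℝ≥0∞ × ℝ≥0∞) × ℝ => radialPairing K p.1.1 p.1.2 p.2 := by
  have hk := measurable_indicator_one hK
  have hφ := measurable_radialInterval_indicator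
  unfold radialPairing
  refine Measurable.lintegral_prod_right (Measurable.lintegral_prod_right ?_)
  refine Measurable.mul (Measurable.mul ?_ ?_) ?_
  · exact hφ.comp (f := fun x : (((ℝ≥0∞ × ℝ≥0∞) × ℝ) × ℝ) × ℝ => (x.1.1.1.1, x.1.2))
      (by fun_prop)
  · exact hφ.comp (f := fun x : (((ℝ≥0∞ × ℝ≥0∞) × ℝ) × ℝ) × ℝ => (x.1.1.1.2, x.2))
      (by fun_prop)
  · exact hk.comp (f := fun x : (((ℝ≥0∞ × ℝ≥0∞) × ℝ) × ℝ) × ℝ => x.1.2 * x.2 * x.1.1.2)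
      (by fun_prop)

theorem lintegral_pair_le_right (hK : MeasurableSet K)
    (hbal : ∀ t ∈ K, ∀ t', |t'| ≤ |t| → t' ∈ K) {g : ℝ → ℝ≥0∞} {F : Set ℝ}
    (hF : MeasurableSet F) (d : ℝ) :
    ∫⁻ r, ∫⁻ s, g r * F.indicator 1 s * K.indicator 1 (r * s * d)
        ∂radialMeasure ∂radialMeasure ≤
      ∫⁻ r, ∫⁻ s, g r * (radialInterval (radialMeasure F)).indicator 1 s *
        K.indicator 1 (r * s * d) ∂radialMeasure ∂radialMeasure := by
  have hk := measurable_indicator_one hK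
  have key : ∀ G : Set ℝ, MeasurableSet G → ∀ r,
      ∫⁻ s, g r * G.indicator 1 s * K.indicator 1 (r * s * d) ∂radialMeasure =
        g r * ∫⁻ s, G.indicator 1 s * K.indicator (1 : ℝ → ℝ≥0∞) (s * (r * d))
          ∂radialMeasure := by
    intro G hG r
    have hkr : Measurable fun s => K.indicator (1 : ℝ → ℝ≥0∞) (s * (r * d)) :=
      hk.comp (by fun_prop)
    rw [← lintegral_const_mul _ (by exact (measurable_indicator_one hG).mul hkr)]
    refine lintegral_congr fun s => ?_
    rw [mul_assoc, show r * s * d = s * (r * d) by ring]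
  refine lintegral_mono fun r => ?_
  rw [key F hF, key _ (measurableSet_radialInterval _)]
  gcongr 1
  exact lintegral_indicator_mul_le hK hbal hF _

theorem lintegral_pair_swap (hK : MeasurableSet K) {f g : ℝ → ℝ≥0∞} (hf : Measurable f)
    (hg : Measurable g) (d : ℝ) :
    ∫⁻ r, ∫⁻ s, f r * g s * K.indicator 1 (r * s * d) ∂radialMeasure ∂radialMeasure =
      ∫⁻ r, ∫⁻ s, g r * f s * K.indicator 1 (r * s * d) ∂radialMeasure ∂radialMeasure := by
  have hk := measurable_indicator_one hK
  rw [lintegral_lintegral_swap]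
  · refine lintegral_congr fun s => lintegral_congr fun r => ?_
    rw [mul_comm (f r), mul_comm r]
  · refine Measurable.aemeasurable (Measurable.mul (Measurable.mul ?_ ?_) ?_)
    · exact hf.comp measurable_fst
    · exact hg.comp measurable_snd
    · exact hk.comp (f := fun x : ℝ × ℝ => x.1 * x.2 * d) (by fun_prop)

theorem lintegral_pair_le_radialPairing (hK : MeasurableSet K)
    (hbal : ∀ t ∈ K, ∀ t', |t'| ≤ |t| → t' ∈ K) {E F : Set ℝ}
    (hE : MeasurableSet E) (hF : MeasurableSet F) (d : ℝ) :
    ∫⁻ r, ∫⁻ s, E.indicator 1 r * F.indicator 1 s * K.indicator 1 (r * s * d)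
        ∂radialMeasure ∂radialMeasure ≤
      radialPairing K (radialMeasure E) (radialMeasure F) d := by
  have hE' := measurable_indicator_one hE
  have hD := fun a => measurable_indicator_one (measurableSet_radialInterval a)
  refine (lintegral_pair_le_right hK hbal hF d).trans ?_
  rw [lintegral_pair_swap hK hE' (hD _)]
  refine (lintegral_pair_le_right hK hbal hE d).trans_eq ?_
  rw [lintegral_pair_swap hK (hD _) (hD _), radialPairing]

theorem radialInterval_indicator_supermodular (a b : ℝ≥0∞) (r s : ℝ) :
    (radialInterval a).indicator (1 : ℝ → ℝ≥0∞) r * (radialInterval b).indicator 1 s +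
        (radialInterval b).indicator 1 r * (radialInterval a).indicator 1 s ≤
      (radialInterval a).indicator 1 r * (radialInterval a).indicator 1 s +
        (radialInterval b).indicator 1 r * (radialInterval b).indicator 1 s := by
  wlog hab : a ≤ b generalizing a b
  · exact (add_comm _ _).trans_le ((this b a (le_of_not_ge hab)).trans_eq (add_comm _ _))
  have hsub : ∀ t, t ∈ radialInterval a → t ∈ radialInterval b :=
    fun t (ht : _ ≤ a) => ht.trans hab
  by_cases hr : r ∈ radialInterval a <;> by_cases hs : s ∈ radialInterval a <;>
    by_cases hr' : r ∈ radialInterval b <;> by_cases hs' : s ∈ radialInterval b <;>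
    simp_all

/-- Polarization of the pairing: this replaces two different radii by equal ones. -/
theorem two_mul_radialPairing_le (hK : MeasurableSet K) (a b : ℝ≥0∞) (d : ℝ) :
    2 * radialPairing K a b d ≤ radialPairing K a a d + radialPairing K b b d := by
  have hk := measurable_indicator_one hK
  have hD := fun a => measurable_indicator_one (measurableSet_radialInterval a)
  have hmeas : ∀ a b : ℝ≥0∞, Measurable fun p : ℝ × ℝ =>
      (radialInterval a).indicator 1 p.1 * (radialInterval b).indicator 1 p.2 *
        K.indicator (1 : ℝ → ℝ≥0∞) (p.1 * p.2 * d) := fun a b =>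
    (((hD a).comp measurable_fst).mul ((hD b).comp measurable_snd)).mul
      (hk.comp (by fun_prop))
  have hadd : ∀ a b a' b' : ℝ≥0∞, radialPairing K a b d + radialPairing K a' b' d =
      ∫⁻ p : ℝ × ℝ, ((radialInterval a).indicator 1 p.1 * (radialInterval b).indicator 1 p.2 +
        (radialInterval a').indicator 1 p.1 * (radialInterval b').indicator 1 p.2) *
        K.indicator (1 : ℝ → ℝ≥0∞) (p.1 * p.2 * d) ∂radialMeasure.prod radialMeasure := by
    intro a b a' b'
    simp_rw [add_mul]
    rw [lintegral_add_left (hmeas a b), lintegral_prod _ (hmeas a b).aemeasurable,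
      lintegral_prod _ (hmeas a' b').aemeasurable]
    rfl
  have hswap : radialPairing K a b d = radialPairing K b a d :=
    lintegral_pair_swap hK (hD a) (hD b) d
  calc 2 * radialPairing K a b d = radialPairing K a b d + radialPairing K b a d := by
        rw [two_mul, ← hswap]
    _ ≤ _ := by
        rw [hadd, hadd]
        refine lintegral_mono fun p => ?_
        gcongr 1
        exact radialInterval_indicator_supermodular a b p.1 p.2

theorem ofReal_abs_mul_lintegral_comp_mul_le {f : ℝ → ℝ≥0∞} (hf : Measurable f) (q : ℝ) :
    ENNReal.ofReal |q| * ∫⁻ d, f (q * d) ≤ ∫⁻ d, f d := by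
  rcases eq_or_ne q 0 with rfl | hq
  · simp
  · rw [← lintegral_map hf (by fun_prop), ← smul_eq_mul, ← lintegral_smul_measure,
      Real.smul_map_volume_mul_left hq]

theorem lintegral_radialPairing_le (hK : MeasurableSet K) (a : ℝ≥0∞) :
    ∫⁻ d, radialPairing K a a d ≤ 4 * a * volume K := by
  have hk := measurable_indicator_one hK
  have hD := measurable_indicator_one (measurableSet_radialInterval a)
  set φ : ℝ → ℝ≥0∞ := (radialInterval a).indicator 1
  set k : ℝ → ℝ≥0∞ := K.indicator 1
  have hm : Measurable fun x : (ℝ × ℝ) × ℝ => φ x.1.1 * φ x.1.2 * k (x.1.1 * x.1.2 * x.2) :=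
    ((hD.comp (by fun_prop)).mul (hD.comp (by fun_prop))).mul (hk.comp (by fun_prop))
  have hk_int : ∫⁻ d, k d = volume K := lintegral_indicator_one hK
  have hφ_int : ∫⁻ r, φ r = volume (radialInterval a) :=
    lintegral_indicator_one (measurableSet_radialInterval a)
  have hH : Measurable fun p : ℝ × ℝ => ∫⁻ d, k (p.1 * p.2 * d) :=
    Measurable.lintegral_prod_right
      (hk.comp (f := fun x : (ℝ × ℝ) × ℝ => x.1.1 * x.1.2 * x.2) (by fun_prop))
  calc ∫⁻ d, radialPairing K a a d
      = ∫⁻ d, ∫⁻ p : ℝ × ℝ, φ p.1 * φ p.2 * k (p.1 * p.2 * d)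
          ∂radialMeasure.prod radialMeasure := by
        refine lintegral_congr fun d => ?_
        have hmd : Measurable fun p : ℝ × ℝ => φ p.1 * φ p.2 * k (p.1 * p.2 * d) :=
          hm.comp (f := fun p : ℝ × ℝ => (p, d)) (by fun_prop)
        rw [lintegral_prod _ hmd.aemeasurable]
        rfl
    _ = ∫⁻ p : ℝ × ℝ, ∫⁻ d : ℝ, φ p.1 * φ p.2 * k (p.1 * p.2 * d) ∂volume
          ∂radialMeasure.prod radialMeasure :=
        lintegral_lintegral_swap
          (hm.comp (f := fun x : ℝ × (ℝ × ℝ) => (x.2, x.1)) (by fun_prop)).aemeasurable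
    _ = ∫⁻ p : ℝ × ℝ, φ p.1 * φ p.2 * (∫⁻ d, k (p.1 * p.2 * d))
          ∂radialMeasure.prod radialMeasure := by
        refine lintegral_congr fun p => ?_
        rw [lintegral_const_mul _
          (by exact hk.comp (f := fun d => p.1 * p.2 * d) (by fun_prop))]
    _ = ∫⁻ r, ∫⁻ s, φ r * φ s * (∫⁻ d, k (r * s * d)) ∂radialMeasure ∂radialMeasure := by
        rw [lintegral_prod _ (Measurable.aemeasurable ?_)]
        exact ((hD.comp measurable_fst).mul (hD.comp measurable_snd)).mul hH
    _ = ∫⁻ r, ∫⁻ s, ENNReal.ofReal |r| *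
          (ENNReal.ofReal |s| * (φ r * φ s * ∫⁻ d, k (r * s * d))) := by
        have hm₂ : Measurable fun p : ℝ × ℝ => φ p.1 * φ p.2 * ∫⁻ d, k (p.1 * p.2 * d) :=
          ((hD.comp measurable_fst).mul (hD.comp measurable_snd)).mul hH
        rw [lintegral_radialMeasure (hm₂.lintegral_prod_right')]
        refine lintegral_congr fun r => ?_
        have hm₃ : Measurable fun s => φ r * φ s * ∫⁻ d, k (r * s * d) :=
          hm₂.comp (f := fun s => (r, s)) (by fun_prop)
        rw [lintegral_radialMeasure hm₃, lintegral_const_mul]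
        exact Measurable.mul (by fun_prop) hm₃
    _ ≤ ∫⁻ r, ∫⁻ s, φ r * (φ s * volume K) := by
        refine lintegral_mono fun r => lintegral_mono fun s => ?_
        calc ENNReal.ofReal |r| * (ENNReal.ofReal |s| * (φ r * φ s * ∫⁻ d, k (r * s * d)))
            = φ r * (φ s * (ENNReal.ofReal |r * s| * ∫⁻ d, k (r * s * d))) := by
              rw [abs_mul, ENNReal.ofReal_mul (abs_nonneg r)]
              ring
          _ ≤ _ := by
              rw [← hk_int]
              gcongr 2
              exact ofReal_abs_mul_lintegral_comp_mul_le hk _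
    _ = volume (radialInterval a) * volume (radialInterval a) * volume K := by
        have h (r : ℝ) : ∫⁻ s, φ r * (φ s * volume K) =
            φ r * (volume (radialInterval a) * volume K) := by
          rw [lintegral_const_mul _ (by exact hD.mul measurable_const),
            lintegral_mul_const _ hD, hφ_int]
        simp_rw [h]
        rw [lintegral_mul_const _ hD, hφ_int, mul_assoc]
    _ ≤ _ := by
        gcongr 1
        exact volume_radialInterval_sq_le a

end Kernel

/-- Integration over the plane in the coordinates `(r, m) ↦ (r, r * m)`. -/
theorem lintegral_plane_eq_slope {f : ℝ × ℝ → ℝ≥0∞} (hf : Measurable f) :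
    ∫⁻ x, f x = ∫⁻ m, ∫⁻ r, f (r, r * m) ∂radialMeasure := by
  have hg : Measurable fun x : ℝ × ℝ => f (x.1, x.1 * x.2) := hf.comp (by fun_prop)
  calc ∫⁻ x, f x = ∫⁻ r, ∫⁻ y, f (r, y) := by
        rw [Measure.volume_eq_prod, lintegral_prod _ hf.aemeasurable]
    _ = ∫⁻ r, ENNReal.ofReal |r| * ∫⁻ m, f (r, r * m) := by
        refine lintegral_congr_ae ?_
        filter_upwards [Measure.ae_ne volume (0 : ℝ)] with r hr
        rw [← lintegral_map (f := fun y => f (r, y)) (g := fun m => r * m)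
            (hf.comp (by fun_prop)) (by fun_prop),
          ← smul_eq_mul, ← lintegral_smul_measure, Real.smul_map_volume_mul_left hr]
    _ = ∫⁻ r, (∫⁻ m, f (r, r * m)) ∂radialMeasure :=
        (lintegral_radialMeasure hg.lintegral_prod_right').symm
    _ = _ := lintegral_lintegral_swap hg.aemeasurable

/-- The part of the line of slope `m` lying in `A`. -/
def slopeFiber (A : Set (ℝ × ℝ)) (m : ℝ) : Set ℝ := {r | (r, r * m) ∈ A}

theorem measurableSet_slopeFiber {A : Set (ℝ × ℝ)} (hA : MeasurableSet A) (m : ℝ) :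
    MeasurableSet (slopeFiber A m) :=
  hA.preimage (f := fun r : ℝ => (r, r * m)) (by fun_prop)

theorem measurable_radialMeasure_slopeFiber {A : Set (ℝ × ℝ)} (hA : MeasurableSet A) :
    Measurable fun m => radialMeasure (slopeFiber A m) := by
  have h : MeasurableSet {p : ℝ × ℝ | (p.2, p.2 * p.1) ∈ A} := hA.preimage (by fun_prop)
  exact measurable_measure_prodMk_left h

theorem lintegral_radialMeasure_slopeFiber {A : Set (ℝ × ℝ)} (hA : MeasurableSet A) :
    ∫⁻ m, radialMeasure (slopeFiber A m) = volume A := by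
  rw [← lintegral_indicator_one hA, lintegral_plane_eq_slope (measurable_one.indicator hA)]
  refine lintegral_congr fun m => ?_
  rw [← lintegral_indicator_one (measurableSet_slopeFiber hA m)]
  rfl

/-- The determinant inequality for the indicator function of a balanced set of determinants. -/
theorem volume_det_mem_le {A : Set (ℝ × ℝ)} (hA : MeasurableSet A) {K : Set ℝ}
    (hK : MeasurableSet K) (hbal : ∀ t ∈ K, ∀ t', |t'| ≤ |t| → t' ∈ K) :
    volume ((A ×ˢ A) ∩ {z : (ℝ × ℝ) × (ℝ × ℝ) | z.1.1 * z.2.2 - z.1.2 * z.2.1 ∈ K}) ≤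
      4 * volume A * volume K := by
  have hk := measurable_indicator_one hK
  have hα := measurable_indicator_one hA
  set k : ℝ → ℝ≥0∞ := K.indicator 1
  set α : ℝ × ℝ → ℝ≥0∞ := A.indicator 1 with hα_def
  set a : ℝ → ℝ≥0∞ := fun m => radialMeasure (slopeFiber A m)
  have ha : Measurable a := measurable_radialMeasure_slopeFiber hA
  have hpair : ∀ u v : ℝ × ℝ → ℝ, Measurable u → Measurable v →
      Measurable fun p : ℝ × ℝ => radialPairing K (a (u p)) (a (v p)) (p.2 - p.1) :=
    fun u v hu hv => (measurable_radialPairing hK).comp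
      (f := fun p : ℝ × ℝ => ((a (u p), a (v p)), p.2 - p.1)) (by fun_prop)
  have hf : Measurable fun z : (ℝ × ℝ) × (ℝ × ℝ) =>
      α z.1 * α z.2 * k (z.1.1 * z.2.2 - z.1.2 * z.2.1) :=
    ((hα.comp measurable_fst).mul (hα.comp measurable_snd)).mul (hk.comp (by fun_prop))
  have hdet : MeasurableSet
      {z : (ℝ × ℝ) × (ℝ × ℝ) | z.1.1 * z.2.2 - z.1.2 * z.2.1 ∈ K} :=
    hK.preimage (f := fun z : (ℝ × ℝ) × (ℝ × ℝ) => z.1.1 * z.2.2 - z.1.2 * z.2.1)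
      (by fun_prop)
  have hcoord : volume ((A ×ˢ A) ∩
      {z : (ℝ × ℝ) × (ℝ × ℝ) | z.1.1 * z.2.2 - z.1.2 * z.2.1 ∈ K}) =
      ∫⁻ m, ∫⁻ n, ∫⁻ r, ∫⁻ s, α (r, r * m) * α (s, s * n) * k (r * s * (n - m))
        ∂radialMeasure ∂radialMeasure := by
    calc _ = ∫⁻ z : (ℝ × ℝ) × (ℝ × ℝ), α z.1 * α z.2 * k (z.1.1 * z.2.2 - z.1.2 * z.2.1) := by
          rw [← lintegral_indicator_one ((hA.prod hA).inter hdet)]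
          simp_rw [Set.inter_indicator_one]
          refine lintegral_congr fun z => ?_
          rw [Pi.mul_apply]
          congr 1
          by_cases h₁ : z.1 ∈ A <;> by_cases h₂ : z.2 ∈ A <;> simp [hα_def, h₁, h₂]
      _ = ∫⁻ x : ℝ × ℝ, ∫⁻ y : ℝ × ℝ, α x * α y * k (x.1 * y.2 - x.2 * y.1) := by
          rw [Measure.volume_eq_prod, lintegral_prod _ hf.aemeasurable]
      _ = ∫⁻ m, ∫⁻ r, (∫⁻ y : ℝ × ℝ,
            α (r, r * m) * α y * k (r * y.2 - r * m * y.1)) ∂radialMeasure :=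
          lintegral_plane_eq_slope hf.lintegral_prod_right'
      _ = ∫⁻ m, ∫⁻ r, (∫⁻ n, ∫⁻ s, α (r, r * m) * α (s, s * n) * k (r * s * (n - m))
            ∂radialMeasure) ∂radialMeasure := by
          refine lintegral_congr fun m => lintegral_congr fun r => ?_
          have hfr : Measurable fun y : ℝ × ℝ =>
              α (r, r * m) * α y * k (r * y.2 - r * m * y.1) :=
            hf.comp (f := fun y : ℝ × ℝ => ((r, r * m), y)) (by fun_prop)
          rw [lintegral_plane_eq_slope hfr]
          refine lintegral_congr fun n => lintegral_congr fun s => ?_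
          congr 2
          ring
      _ = _ := by
          refine lintegral_congr fun m => lintegral_lintegral_swap ?_
          refine (Measurable.lintegral_prod_right ?_).aemeasurable
          exact ((hα.comp (f := fun x : (ℝ × ℝ) × ℝ => (x.1.1, x.1.1 * m)) (by fun_prop)).mul
            (hα.comp (f := fun x : (ℝ × ℝ) × ℝ => (x.2, x.2 * x.1.2)) (by fun_prop))).mul
            (hk.comp (f := fun x : (ℝ × ℝ) × ℝ => x.1.1 * x.2 * (x.1.2 - m)) (by fun_prop))
  have hint : 4 * volume A * volume K = ∫⁻ m, 4 * a m * volume K := by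
    rw [lintegral_mul_const _ (by fun_prop), lintegral_const_mul _ ha,
      lintegral_radialMeasure_slopeFiber hA]
  have hleft : ∫⁻ m, ∫⁻ n, radialPairing K (a m) (a m) (n - m) ≤ 4 * volume A * volume K := by
    rw [hint]
    refine lintegral_mono fun m => ?_
    rw [lintegral_sub_right_eq_self (fun d => radialPairing K (a m) (a m) d)]
    exact lintegral_radialPairing_le hK _
  have hright : ∫⁻ m, ∫⁻ n, radialPairing K (a n) (a n) (n - m) ≤ 4 * volume A * volume K := by
    rw [lintegral_lintegral_swap
      (hpair _ _ measurable_snd measurable_snd).aemeasurable, hint]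
    refine lintegral_mono fun n => ?_
    rw [lintegral_sub_left_eq_self (fun d => radialPairing K (a n) (a n) d)]
    exact lintegral_radialPairing_le hK _
  have hbound : ∀ m n, ∫⁻ r, ∫⁻ s, α (r, r * m) * α (s, s * n) * k (r * s * (n - m))
      ∂radialMeasure ∂radialMeasure ≤ radialPairing K (a m) (a n) (n - m) := fun m n =>
    lintegral_pair_le_radialPairing hK hbal (measurableSet_slopeFiber hA m)
      (measurableSet_slopeFiber hA n) (n - m)
  rw [hcoord, ← ENNReal.mul_le_mul_iff_right two_ne_zero ENNReal.ofNat_ne_top]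
  calc 2 * ∫⁻ m, ∫⁻ n, ∫⁻ r, ∫⁻ s, α (r, r * m) * α (s, s * n) * k (r * s * (n - m))
        ∂radialMeasure ∂radialMeasure
      ≤ 2 * ∫⁻ m, ∫⁻ n, radialPairing K (a m) (a n) (n - m) := by
        gcongr with m n
        exact hbound m n
    _ = ∫⁻ m, ∫⁻ n, 2 * radialPairing K (a m) (a n) (n - m) := by
        have h := hpair _ _ measurable_fst measurable_snd
        rw [← lintegral_const_mul _ h.lintegral_prod_right']
        refine lintegral_congr fun m => ?_
        rw [lintegral_const_mul _ (by exact h.comp (f := fun n => (m, n)) (by fun_prop))]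
    _ ≤ ∫⁻ m, ∫⁻ n, (radialPairing K (a m) (a m) (n - m) +
          radialPairing K (a n) (a n) (n - m)) :=
        lintegral_mono fun m => lintegral_mono fun n => two_mul_radialPairing_le hK _ _ _
    _ = (∫⁻ m, ∫⁻ n, radialPairing K (a m) (a m) (n - m)) +
          ∫⁻ m, ∫⁻ n, radialPairing K (a n) (a n) (n - m) := by
        have h := hpair _ _ measurable_fst measurable_fst
        rw [← lintegral_add_left h.lintegral_prod_right']
        refine lintegral_congr fun m => ?_
        rw [lintegral_add_left (by exact h.comp (f := fun n => (m, n)) (by fun_prop))]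
    _ ≤ 2 * (4 * volume A * volume K) := by
        rw [two_mul]
        exact add_le_add hleft hright

/-- The determinant inequality for a non-increasing weight on `[0, ∞)`. -/
theorem lintegral_antitone_det_le {A : Set (ℝ × ℝ)} (hA : MeasurableSet A) {ψ : ℝ → ℝ}
    (hψ : Antitone ψ) (hψ₀ : ∀ t, 0 ≤ ψ t) :
    ∫⁻ z in A ×ˢ A, ENNReal.ofReal (ψ |z.1.1 * z.2.2 - z.1.2 * z.2.1|) ≤
      8 * volume A * ∫⁻ t in Set.Ici 0, ENNReal.ofReal (ψ t) := by
  have hψm : Measurable ψ := hψ.measurable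
  have hψabs : Measurable fun t => ψ |t| := hψm.comp (by fun_prop)
  have hdet : Measurable fun z : (ℝ × ℝ) × (ℝ × ℝ) => z.1.1 * z.2.2 - z.1.2 * z.2.1 := by
    fun_prop
  have heven : ∫⁻ t, ENNReal.ofReal (ψ |t|) = 2 * ∫⁻ t in Set.Ici 0, ENNReal.ofReal (ψ t) := by
    rw [← lintegral_add_compl _ (measurableSet_Ici (a := (0 : ℝ))), two_mul]
    congr 1
    · exact setLIntegral_congr_fun measurableSet_Ici fun t ht => by
        simp only [abs_of_nonneg (Set.mem_Ici.1 ht)]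
    · rw [Set.compl_Ici, setLIntegral_congr (Ioi_ae_eq_Ici (a := (0 : ℝ))).symm,
        ← lintegral_indicator measurableSet_Iio, ← lintegral_indicator measurableSet_Ioi,
        ← lintegral_neg_eq_self]
      refine lintegral_congr fun t => ?_
      by_cases ht : 0 < t
      · simp [ht, abs_of_pos ht]
      · simp [ht]
  rw [lintegral_eq_lintegral_meas_lt _ (Filter.Eventually.of_forall fun _ => hψ₀ _)
    (hψabs.comp hdet).aemeasurable]
  calc ∫⁻ u in Set.Ioi 0, volume.restrict (A ×ˢ A)
        {z : (ℝ × ℝ) × (ℝ × ℝ) | u < ψ |z.1.1 * z.2.2 - z.1.2 * z.2.1|}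
      ≤ ∫⁻ u in Set.Ioi 0, 4 * volume A * volume {t | u < ψ |t|} := by
        refine lintegral_mono fun u => ?_
        have hK : MeasurableSet {t | u < ψ |t|} := measurableSet_lt measurable_const hψabs
        have hpre : MeasurableSet
            {z : (ℝ × ℝ) × (ℝ × ℝ) | u < ψ |z.1.1 * z.2.2 - z.1.2 * z.2.1|} :=
          hK.preimage hdet
        rw [Measure.restrict_apply hpre, Set.inter_comm]
        exact volume_det_mem_le hA hK fun t ht t' htt' => lt_of_lt_of_le ht (hψ htt')
    _ = 4 * volume A * ∫⁻ t, ENNReal.ofReal (ψ |t|) := by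
        rw [lintegral_eq_lintegral_meas_lt _ (Filter.Eventually.of_forall fun _ => hψ₀ _)
          hψabs.aemeasurable, lintegral_const_mul]
        refine Antitone.measurable fun u v huv => measure_mono fun t ht => ?_
        exact lt_of_le_of_lt huv ht
    _ = _ := by
        rw [heven]
        ring

/-- **Schmidt's determinant-weight inequality on `ℝ²`** (Lemma 5.3 (2)).  If
`χ : ℝ → [0,∞)` vanishes outside `[r₀, r₁]` (with `0 ≤ r₀ < r₁ ≤ ∞`), is non-increasing
there and has finite integral, then for every Borel `A ⊆ ℝ²`,
`∬ χ(|det(x,y)|)·1_A(x)·1_A(y) dx dy ≤ 8·λ(A)·(r₀ χ(r₀) + ∫_{r₀}^{r₁} χ)`. -/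
theorem schmidt_determinant_weight_inequality
    (r₀ : ℝ) (r₁ : ℝ≥0∞) (hr₀ : 0 ≤ r₀) (hr : ENNReal.ofReal r₀ < r₁)
    (χ : ℝ → ℝ)
    (I : Set ℝ) (hI : I = {t : ℝ | r₀ ≤ t ∧ ENNReal.ofReal t ≤ r₁})
    (hχ_nonneg : ∀ t, 0 ≤ χ t)
    (hχ_vanish : ∀ t ∉ I, χ t = 0)
    (hχ_anti : AntitoneOn χ I)
    (hχ_int : ∫⁻ t in I, ENNReal.ofReal (χ t) ≠ ⊤)
    (A : Set (ℝ × ℝ)) (hA : MeasurableSet A) :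
    ∫⁻ z : (ℝ × ℝ) × (ℝ × ℝ),
        ENNReal.ofReal (χ |z.1.1 * z.2.2 - z.1.2 * z.2.1|) *
          A.indicator (fun _ => (1 : ℝ≥0∞)) z.1 *
          A.indicator (fun _ => (1 : ℝ≥0∞)) z.2 ≤
      8 * volume A *
        (ENNReal.ofReal (r₀ * χ r₀) + ∫⁻ t in I, ENNReal.ofReal (χ t)) := by
  have hanti : AntitoneOn χ (Set.Ici r₀) := by
    intro s hs t ht hst
    by_cases htI : t ∈ I
    · have hsI : s ∈ I := by
        rw [hI] at htI ⊢
        exact ⟨hs, (ENNReal.ofReal_le_ofReal hst).trans htI.2⟩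
      exact hχ_anti hsI htI hst
    · rw [hχ_vanish t htI]
      exact hχ_nonneg s
  set ψ : ℝ → ℝ := fun t => χ (max r₀ t) with hψ_def
  have hψ : Antitone ψ := fun s t hst =>
    hanti (Set.mem_Ici.2 (le_max_left _ _)) (Set.mem_Ici.2 (le_max_left _ _)) (max_le_max_left _ hst)
  have hχψ : ∀ t, χ t ≤ ψ t := by
    intro t
    rcases le_total r₀ t with h | h
    · simp [hψ_def, max_eq_right h]
    · rcases h.eq_or_lt with rfl | h
      · simp [hψ_def]
      · rw [hχ_vanish t (by rw [hI]; exact fun ht => h.not_ge ht.1)]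
        exact hχ_nonneg _
  have hI_meas : MeasurableSet I := by
    rw [hI]
    exact (measurableSet_le measurable_const measurable_id).inter
      (measurableSet_le ENNReal.measurable_ofReal measurable_const)
  have htail : ∫⁻ t in Set.Ici r₀, ENNReal.ofReal (ψ t) = ∫⁻ t in I, ENNReal.ofReal (χ t) := by
    rw [← lintegral_indicator measurableSet_Ici, ← lintegral_indicator hI_meas]
    refine lintegral_congr fun t => ?_
    by_cases htI : t ∈ I
    · have ht : r₀ ≤ t := by
        rw [hI] at htI
        exact htI.1
      simp [htI, ht, hψ_def]
    · by_cases ht : r₀ ≤ t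
      · simp [htI, ht, hψ_def, hχ_vanish t htI]
      · simp [htI, ht]
  have hψ_int : ∫⁻ t in Set.Ici 0, ENNReal.ofReal (ψ t) ≤
      ENNReal.ofReal (r₀ * χ r₀) + ∫⁻ t in I, ENNReal.ofReal (χ t) := by
    rw [← Set.Ico_union_Ici_eq_Ici hr₀, ← htail]
    refine (lintegral_union_le _ _ _).trans (add_le_add_left (le_of_eq ?_) _)
    rw [setLIntegral_congr_fun (g := fun _ => ENNReal.ofReal (χ r₀)) measurableSet_Ico
      fun t ht => by simp [hψ_def, max_eq_left ht.2.le], setLIntegral_const,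
      Real.volume_Ico, sub_zero, mul_comm, ENNReal.ofReal_mul hr₀]
  calc _ ≤ ∫⁻ z in A ×ˢ A, ENNReal.ofReal (ψ |z.1.1 * z.2.2 - z.1.2 * z.2.1|) := by
        rw [← lintegral_indicator (hA.prod hA)]
        refine lintegral_mono fun z => ?_
        by_cases h₁ : z.1 ∈ A <;> by_cases h₂ : z.2 ∈ A <;>
          simp only [Set.indicator, Set.mem_prod, h₁, h₂, and_self, and_true, and_false, if_true,
            if_false, mul_one, mul_zero, le_refl]
        exact ENNReal.ofReal_le_ofReal (hχψ _)
    _ ≤ _ := lintegral_antitone_det_le hA hψ fun _ => hχ_nonneg _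
    _ ≤ _ := by gcongr
end

section
/- Let p be a prime, let vol_p denote the additive Haar measure on ℚ_p² normalized so that vol_p(ℤ_p²) = 1, let A ⊆ ℚ_p² be a Borel set, and let t ∈ ℤ. Then (vol_p ⊗ vol_p)( {(x, y) ∈ A × A : |x₁y₂ − x₂y₁|_p = p^t} ) ≤ p^t·(1 − p^{−2})·vol_p(A), where x = (x₁, x₂), y = (y₁, y₂), and |·|_p is the p-adic absolute value. -/
open MeasureTheory ENNReal

namespace Padic

variable {p : ℕ} [Fact p.Prime]

/-- A closed ball of radius `p ^ (n + 1)` is a union of `p` translates of the closed ball of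
radius `p ^ n`. -/
theorem closedBall_zpow_succ (n : ℤ) :
    Metric.closedBall (0 : ℚ_[p]) ((p : ℝ) ^ (n + 1)) =
      ⋃ i ∈ Finset.range p,
        Metric.closedBall ((i : ℚ_[p]) * (p : ℚ_[p]) ^ (-(n + 1))) ((p : ℝ) ^ n) := by
  have hp : (0 : ℝ) < p := mod_cast (Fact.out : p.Prime).pos
  have hp0 : (p : ℚ_[p]) ≠ 0 := mod_cast (Fact.out : p.Prime).ne_zero
  ext x
  simp only [mem_closedBall_iff_norm, sub_zero, Set.mem_iUnion, Finset.mem_range, exists_prop]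
  constructor
  · intro hx
    have hy : ‖x * (p : ℚ_[p]) ^ (n + 1)‖ ≤ 1 := by
      rw [norm_mul, norm_p_zpow, zpow_neg]
      exact mul_inv_le_one_of_le₀ hx (by positivity)
    obtain ⟨i, hi, h⟩ := PadicInt.exists_mem_range (⟨_, hy⟩ : ℤ_[p])
    refine ⟨i, hi, ?_⟩
    rw [PadicInt.maximalIdeal_eq_span_p, Ideal.mem_span_singleton,
      ← PadicInt.norm_lt_one_iff_dvd, PadicInt.norm_def] at h
    rw [norm_le_pow_iff_norm_lt_pow_add_one]
    have e : x - i * (p : ℚ_[p]) ^ (-(n + 1)) =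
        (x * (p : ℚ_[p]) ^ (n + 1) - i) * (p : ℚ_[p]) ^ (-(n + 1)) := by
      rw [zpow_neg]; field_simp
    rw [e, norm_mul, norm_p_zpow, neg_neg]
    exact mul_lt_of_lt_one_left (by positivity) h
  · rintro ⟨i, -, h⟩
    rw [← sub_add_cancel x (i * (p : ℚ_[p]) ^ (-(n + 1)))]
    refine (IsUltrametricDist.norm_add_le_max _ _).trans (max_le (h.trans ?_) ?_)
    · exact zpow_le_zpow_right₀ (mod_cast (Fact.out : p.Prime).one_le) (by lia)
    · rw [norm_mul, norm_p_zpow, neg_neg]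
      exact mul_le_of_le_one_left (by positivity) (mod_cast norm_int_le_one (i : ℤ))

theorem pairwiseDisjoint_closedBall_zpow (n : ℤ) :
    (Finset.range p : Set ℕ).PairwiseDisjoint fun i ↦
      Metric.closedBall ((i : ℚ_[p]) * (p : ℚ_[p]) ^ (-(n + 1))) ((p : ℝ) ^ n) := by
  have hp : (0 : ℝ) < p := mod_cast (Fact.out : p.Prime).pos
  intro i hi j hj hij
  refine Set.disjoint_left.2 fun x hxi hxj ↦ hij ?_
  simp only [Finset.coe_range, Set.mem_Iio] at hi hj
  rw [Metric.mem_closedBall] at hxi hxj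
  have h : dist ((i : ℚ_[p]) * (p : ℚ_[p]) ^ (-(n + 1))) (j * (p : ℚ_[p]) ^ (-(n + 1))) ≤
      (p : ℝ) ^ n :=
    (IsUltrametricDist.dist_triangle_max _ x _).trans (max_le (dist_comm x _ ▸ hxi) hxj)
  rw [dist_eq_norm, ← sub_mul, norm_mul, norm_p_zpow, neg_neg] at h
  have h1 : ‖(((i : ℤ) - j : ℤ) : ℚ_[p])‖ < 1 := by
    push_cast
    refine lt_of_mul_lt_mul_right ((h.trans_lt ?_).trans_eq (one_mul _).symm)
      (zpow_nonneg hp.le (n + 1))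
    exact zpow_lt_zpow_right₀ (mod_cast (Fact.out : p.Prime).one_lt) (by lia)
  rw [norm_intCast_lt_one_iff] at h1
  have := Int.eq_zero_of_abs_lt_dvd h1 (abs_lt.2 ⟨by lia, by lia⟩)
  lia

theorem measure_closedBall_zpow_succ (μ : Measure ℚ_[p]) [μ.IsAddLeftInvariant] (n : ℤ) :
    μ (Metric.closedBall 0 ((p : ℝ) ^ (n + 1))) = p * μ (Metric.closedBall 0 ((p : ℝ) ^ n)) := by
  rw [closedBall_zpow_succ, measure_biUnion_finset (pairwiseDisjoint_closedBall_zpow n)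
    fun _ _ ↦ Metric.isClosed_closedBall.measurableSet]
  have h (a : ℚ_[p]) (r : ℝ) : μ (Metric.closedBall a r) = μ (Metric.closedBall 0 r) := by
    rw [← measure_preimage_add μ a, preimage_add_closedBall, sub_self]
  simp [h]

theorem measure_closedBall_zpow (μ : Measure ℚ_[p]) [μ.IsAddLeftInvariant]
    (hμ : μ (Metric.closedBall 0 1) = 1) (n : ℤ) :
    μ (Metric.closedBall 0 ((p : ℝ) ^ n)) = ENNReal.ofReal ((p : ℝ) ^ n) := by
  have hp : (0 : ℝ) < p := mod_cast (Fact.out : p.Prime).pos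
  have hp0 : (p : ℝ≥0∞) ≠ 0 := mod_cast (Fact.out : p.Prime).ne_zero
  have e (n : ℤ) : ENNReal.ofReal ((p : ℝ) ^ (n + 1)) = p * ENNReal.ofReal ((p : ℝ) ^ n) := by
    rw [zpow_add_one₀ hp.ne', mul_comm, ENNReal.ofReal_mul hp.le, ENNReal.ofReal_natCast]
  induction n with
  | zero => simpa using hμ
  | succ k ih => rw [measure_closedBall_zpow_succ, ih, e]
  | pred k ih =>
    rw [← sub_add_cancel (-(k : ℤ)) 1, measure_closedBall_zpow_succ, e] at ih
    exact (ENNReal.mul_right_inj hp0 (ENNReal.natCast_ne_top p)).1 ih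

theorem measure_sphere_zpow (μ : Measure ℚ_[p]) [μ.IsAddLeftInvariant]
    (hμ : μ (Metric.closedBall 0 1) = 1) (n : ℤ) :
    μ (Metric.sphere 0 ((p : ℝ) ^ n)) = ENNReal.ofReal ((p : ℝ) ^ n * (1 - (p : ℝ)⁻¹)) := by
  have hp : (0 : ℝ) < p := mod_cast (Fact.out : p.Prime).pos
  have h : Metric.sphere (0 : ℚ_[p]) ((p : ℝ) ^ n) =
      Metric.closedBall 0 ((p : ℝ) ^ n) \ Metric.closedBall 0 ((p : ℝ) ^ (n - 1)) := by
    ext x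
    simp [← norm_lt_pow_iff_norm_le_pow_sub_one, le_antisymm_iff]
  rw [h, measure_sdiff (Metric.closedBall_subset_closedBall
      (zpow_le_zpow_right₀ (mod_cast (Fact.out : p.Prime).one_le) (by lia)))
      Metric.isClosed_closedBall.nullMeasurableSet (by simp [measure_closedBall_zpow μ hμ]),
    measure_closedBall_zpow μ hμ, measure_closedBall_zpow μ hμ, ← ENNReal.ofReal_sub _
      (by positivity), zpow_sub_one₀ hp.ne', mul_sub, mul_one]

theorem measure_setOf_norm_mul_sub_eq (μ : Measure ℚ_[p]) [μ.IsAddLeftInvariant]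
    (hμ : μ (Metric.closedBall 0 1) = 1) {a : ℚ_[p]} {k : ℤ} (ha : ‖a‖ = (p : ℝ) ^ k)
    (b : ℚ_[p]) (t : ℤ) :
    μ {y | ‖a * y - b‖ = (p : ℝ) ^ t} =
      ENNReal.ofReal ((p : ℝ) ^ (t - k) * (1 - (p : ℝ)⁻¹)) := by
  have hp : (0 : ℝ) < p := mod_cast (Fact.out : p.Prime).pos
  have ha0 : a ≠ 0 := by
    rintro rfl
    exact (zpow_pos hp k).ne (by simpa using ha)
  rw [← measure_sphere_zpow μ hμ, ← measure_preimage_add μ (b / a)]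
  congr 1
  ext y
  have e : a * (b / a + y) - b = a * y := by field_simp; ring
  simp only [Set.mem_ofPred_eq, Set.mem_preimage, mem_sphere_zero_iff_norm]
  rw [e, norm_mul, ha, zpow_sub₀ hp.ne', eq_div_iff (zpow_pos hp k).ne', mul_comm]

theorem measurableSet_setOf_norm_det_eq (r : ℝ) :
    MeasurableSet {z : (ℚ_[p] × ℚ_[p]) × (ℚ_[p] × ℚ_[p]) |
      ‖z.1.1 * z.2.2 - z.1.2 * z.2.1‖ = r} :=
  (isClosed_eq (by fun_prop) continuous_const).measurableSet

theorem prod_measure_strip (μ : Measure ℚ_[p]) [μ.IsAddHaarMeasure]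
    (hμ : μ (Metric.closedBall 0 1) = 1) {a : ℚ_[p]} {k : ℤ} (ha : ‖a‖ = (p : ℝ) ^ k)
    (b : ℚ_[p]) (n t : ℤ) :
    μ.prod μ {y | ‖y.1‖ ≤ (p : ℝ) ^ n ∧ ‖a * y.2 - b * y.1‖ = (p : ℝ) ^ t} =
      ENNReal.ofReal ((p : ℝ) ^ (n + t - k) * (1 - (p : ℝ)⁻¹)) := by
  have hp : (0 : ℝ) < p := mod_cast (Fact.out : p.Prime).pos
  have hm : MeasurableSet {y : ℚ_[p] × ℚ_[p] |
      ‖y.1‖ ≤ (p : ℝ) ^ n ∧ ‖a * y.2 - b * y.1‖ = (p : ℝ) ^ t} := by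
    rw [Set.ofPred_and]
    exact ((isClosed_le (by fun_prop) continuous_const).inter
      (isClosed_eq (by fun_prop) continuous_const)).measurableSet
  rw [Measure.prod_apply hm]
  have e (u : ℚ_[p]) : μ (Prod.mk u ⁻¹' {y : ℚ_[p] × ℚ_[p] |
      ‖y.1‖ ≤ (p : ℝ) ^ n ∧ ‖a * y.2 - b * y.1‖ = (p : ℝ) ^ t}) =
      (Metric.closedBall 0 ((p : ℝ) ^ n)).indicator
        (fun _ ↦ ENNReal.ofReal ((p : ℝ) ^ (t - k) * (1 - (p : ℝ)⁻¹))) u := by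
    by_cases hu : ‖u‖ ≤ (p : ℝ) ^ n
    · simp [hu, measure_setOf_norm_mul_sub_eq μ hμ ha]
    · simp [hu]
  simp_rw [e]
  rw [lintegral_indicator_const Metric.isClosed_closedBall.measurableSet,
    measure_closedBall_zpow μ hμ, mul_comm, ← ENNReal.ofReal_mul (by positivity), ← mul_assoc,
    ← zpow_add₀ hp.ne', add_sub_assoc]

/-- The `y` in a ball whose determinant with a fixed vector `x` has a given absolute value are
contained in a strip of known measure. -/
theorem prod_measure_setOf_norm_det_eq_le (μ : Measure ℚ_[p]) [μ.IsAddHaarMeasure]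
    (hμ : μ (Metric.closedBall 0 1) = 1) (x : ℚ_[p] × ℚ_[p]) {k : ℤ} (hx : ‖x‖ = (p : ℝ) ^ k)
    (n t : ℤ) :
    μ.prod μ {y | ‖y‖ ≤ (p : ℝ) ^ n ∧ ‖x.1 * y.2 - x.2 * y.1‖ = (p : ℝ) ^ t} ≤
      ENNReal.ofReal ((p : ℝ) ^ (n + t - k) * (1 - (p : ℝ)⁻¹)) := by
  rcases le_total ‖x.2‖ ‖x.1‖ with h | h
  · rw [Prod.norm_def, max_eq_left h] at hx
    rw [← prod_measure_strip μ hμ hx x.2]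
    exact measure_mono fun y hy ↦ ⟨(norm_fst_le y).trans hy.1, hy.2⟩
  · rw [Prod.norm_def, max_eq_right h] at hx
    rw [← prod_measure_strip μ hμ hx x.1,
      ← Measure.measurePreserving_swap.measure_preimage_equiv (f := MeasurableEquiv.prodComm)]
    refine measure_mono fun y hy ↦ ⟨(norm_snd_le y.swap).trans hy.1, ?_⟩
    exact (norm_sub_rev _ _).trans hy.2

/-- The Haar measure on `ℚ_p²` giving mass `1` to `ℤ_p²` is a product measure. -/
theorem exists_eq_prod_of_isAddHaarMeasure (ν : Measure (ℚ_[p] × ℚ_[p])) [ν.IsAddHaarMeasure]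
    (hν : ν (Metric.closedBall 0 1) = 1) :
    ∃ μ : Measure ℚ_[p], μ.IsAddHaarMeasure ∧ μ (Metric.closedBall 0 1) = 1 ∧ ν = μ.prod μ := by
  let K : TopologicalSpace.PositiveCompacts ℚ_[p] :=
    ⟨⟨Metric.closedBall 0 1, isCompact_closedBall 0 1⟩,
      ⟨0, Metric.ball_subset_interior_closedBall (Metric.mem_ball_self one_pos)⟩⟩
  have hK : Measure.addHaarMeasure K (Metric.closedBall 0 1) = 1 := Measure.addHaarMeasure_self
  refine ⟨Measure.addHaarMeasure K, inferInstance, hK, ?_⟩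
  have h := Measure.isAddLeftInvariant_eq_smul ν
    ((Measure.addHaarMeasure K).prod (Measure.addHaarMeasure K))
  have hc := hν
  rw [h, Measure.smul_apply, show (0 : ℚ_[p] × ℚ_[p]) = (0, 0) from rfl, ← closedBall_prod_same,
    Measure.prod_prod, hK, mul_one, ENNReal.smul_def, smul_eq_mul, mul_one] at hc
  rw [h, ENNReal.coe_eq_one.1 hc, one_smul]

/-- Summing the bounds over `‖y‖ ≤ ‖x‖` and `‖y‖ < ‖x‖` gives the sharp constant. -/
theorem measure_norm_le_add_measure_norm_lt_le (ν : Measure (ℚ_[p] × ℚ_[p])) [ν.IsAddHaarMeasure]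
    (hν : ν (Metric.closedBall 0 1) = 1) (x : ℚ_[p] × ℚ_[p]) (t : ℤ) :
    ν {y | ‖y‖ ≤ ‖x‖ ∧ ‖x.1 * y.2 - x.2 * y.1‖ = (p : ℝ) ^ t} +
        ν {y | ‖y‖ < ‖x‖ ∧ ‖x.1 * y.2 - x.2 * y.1‖ = (p : ℝ) ^ t} ≤
      ENNReal.ofReal ((p : ℝ) ^ t * (1 - ((p : ℝ) ^ 2)⁻¹)) := by
  have hp : (1 : ℝ) < p := mod_cast (Fact.out : p.Prime).one_lt
  have hp0 : (0 : ℝ) < p := one_pos.trans hp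
  obtain ⟨μ, _, hμ, rfl⟩ := exists_eq_prod_of_isAddHaarMeasure ν hν
  rcases eq_or_ne x 0 with rfl | hx
  · simp [(zpow_pos hp0 t).ne]
  obtain ⟨k, hk⟩ : ∃ k : ℤ, ‖x‖ = (p : ℝ) ^ k := by
    have aux (a : ℚ_[p]) (ha : ‖x‖ = ‖a‖) : ∃ k : ℤ, ‖x‖ = (p : ℝ) ^ k :=
      ⟨_, ha.trans (norm_eq_zpow_neg_valuation (norm_ne_zero_iff.1 (ha ▸ norm_ne_zero_iff.2 hx)))⟩
    exact (max_choice ‖x.1‖ ‖x.2‖).elim (aux _) (aux _)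
  have hlt (y : ℚ_[p] × ℚ_[p]) : ‖y‖ < (p : ℝ) ^ k ↔ ‖y‖ ≤ (p : ℝ) ^ (k - 1) := by
    simp [Prod.norm_def, norm_lt_pow_iff_norm_le_pow_sub_one]
  simp_rw [hk, hlt]
  refine (add_le_add (prod_measure_setOf_norm_det_eq_le μ hμ x hk k t)
    (prod_measure_setOf_norm_det_eq_le μ hμ x hk (k - 1) t)).trans_eq ?_
  have h1 : 0 ≤ 1 - (p : ℝ)⁻¹ := sub_nonneg.2 (inv_le_one_of_one_le₀ hp.le)
  rw [← ENNReal.ofReal_add (by positivity) (by positivity), show k + t - k = t by ring,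
    show k - 1 + t - k = t - 1 by ring, zpow_sub_one₀ hp0.ne']
  congr 1
  ring

end Padic

/-- **`p`-adic determinant-level inequality** (Lemma 5.3 (3)).  Let `vol_p` be the additive
Haar measure on `ℚ_p²` with `vol_p(ℤ_p²) = 1`.  For every Borel `A ⊆ ℚ_p²` and `t ∈ ℤ`,
the `vol_p ⊗ vol_p`-measure of `{(x,y) ∈ A × A : |x₁y₂ − x₂y₁|_p = p^t}` is at most
`p^t (1 − p⁻²) vol_p(A)`. -/
theorem padic_determinant_level_inequality
    (p : ℕ) [Fact p.Prime]
    (volp : Measure (ℚ_[p] × ℚ_[p]))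
    (hHaar : volp.IsAddHaarMeasure) (hreg : volp.Regular)
    (hnorm : volp {x : ℚ_[p] × ℚ_[p] | ‖x.1‖ ≤ 1 ∧ ‖x.2‖ ≤ 1} = 1)
    (A : Set (ℚ_[p] × ℚ_[p])) (hA : MeasurableSet A) (t : ℤ) :
    (volp.prod volp)
        {z : (ℚ_[p] × ℚ_[p]) × (ℚ_[p] × ℚ_[p]) |
          (z.1 ∈ A ∧ z.2 ∈ A) ∧ ‖z.1.1 * z.2.2 - z.1.2 * z.2.1‖ = (p : ℝ) ^ t} ≤
      ENNReal.ofReal ((p : ℝ) ^ t * (1 - ((p : ℝ) ^ 2)⁻¹)) * volp A := by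
  have hν : volp (Metric.closedBall 0 1) = 1 := by
    rw [← hnorm]
    congr 1
    ext x
    simp [Prod.norm_def]
  have hdet := Padic.measurableSet_setOf_norm_det_eq (p := p) ((p : ℝ) ^ t)
  let D : (ℚ_[p] × ℚ_[p]) → (ℚ_[p] × ℚ_[p]) → Prop := fun x y ↦
    ‖x.1 * y.2 - x.2 * y.1‖ = (p : ℝ) ^ t
  have hD (x y : ℚ_[p] × ℚ_[p]) : D x y ↔ D y x := by
    simp only [D]
    rw [norm_sub_rev, mul_comm x.2, mul_comm x.1]
  let F : Set ((ℚ_[p] × ℚ_[p]) × (ℚ_[p] × ℚ_[p])) := {z | z.1 ∈ A ∧ ‖z.2‖ ≤ ‖z.1‖ ∧ D z.1 z.2}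
  let G : Set ((ℚ_[p] × ℚ_[p]) × (ℚ_[p] × ℚ_[p])) := {z | z.2 ∈ A ∧ ‖z.1‖ < ‖z.2‖ ∧ D z.1 z.2}
  have hF : MeasurableSet F := by
    simp only [F, Set.ofPred_and]
    exact (measurable_fst hA).inter
      ((measurableSet_le (by fun_prop) (by fun_prop)).inter hdet)
  have hG : MeasurableSet G := by
    simp only [G, Set.ofPred_and]
    exact (measurable_snd hA).inter
      ((measurableSet_lt (by fun_prop) (by fun_prop)).inter hdet)
  have hle (x : ℚ_[p] × ℚ_[p]) :
      volp (Prod.mk x ⁻¹' F) + volp ((fun y ↦ (y, x)) ⁻¹' G) ≤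
        A.indicator (fun _ ↦ ENNReal.ofReal ((p : ℝ) ^ t * (1 - ((p : ℝ) ^ 2)⁻¹))) x := by
    by_cases hx : x ∈ A
    · simpa [F, G, hx, hD _ x] using Padic.measure_norm_le_add_measure_norm_lt_le volp hν x t
    · simp [F, G, hx]
  calc
    _ ≤ (volp.prod volp) (F ∪ G) := measure_mono fun z hz ↦
      (le_or_gt ‖z.2‖ ‖z.1‖).imp (fun h ↦ ⟨hz.1.1, h, hz.2⟩) (fun h ↦ ⟨hz.1.2, h, hz.2⟩)
    _ ≤ (volp.prod volp) F + (volp.prod volp) G := measure_union_le _ _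
    _ = ∫⁻ x, volp (Prod.mk x ⁻¹' F) + volp ((fun y ↦ (y, x)) ⁻¹' G) ∂volp := by
      rw [Measure.prod_apply hF, Measure.prod_apply_symm hG,
        lintegral_add_left (measurable_measure_prodMk_left hF)]
    _ ≤ _ := (lintegral_mono hle).trans_eq (lintegral_indicator_const hA _)
end

section
/- Let A = A_∞ × ∏_{p ∈ S_f} A_p ⊆ ℚ_S² where A_∞ ⊆ ℝ² and each A_p ⊆ ℚ_p² are Borel sets with vol_S(A) > 0. Let r > 1 and let χ : ℝ → [0, ∞) vanish outside [1, r] and be non-increasing on [1, r]. Then ∬_{{(x, y) ∈ ℚ_S² × ℚ_S² : |det(x_p, y_p)|_p > 1 for every p ∈ S}} 1_A(x)·1_A(y)·χ( ∏_{p ∈ S} |det(x_p, y_p)|_p ) dvol_S(x) dvol_S(y) ≤ 8·vol_S(A)·[ ∏_{p ∈ S_f} (log_p r)·(1 − p^{−2}) ]·[ χ(1) + ∫_1^r χ(t) dt ]. -/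
open MeasureTheory Matrix ENNReal

/-- The weight `2` below the diagonal `a = b`, `1` on it and `0` above it. -/
noncomputable def belowDiagWeight (a b : ℝ) : ℝ≥0∞ := if a < b then 2 else if a = b then 1 else 0

lemma measurable_belowDiagWeight : Measurable fun z : ℝ × ℝ => belowDiagWeight z.1 z.2 := by
  unfold belowDiagWeight
  exact Measurable.ite (measurableSet_lt measurable_fst measurable_snd) measurable_const
    (Measurable.ite (measurableSet_eq_fun measurable_fst measurable_snd) measurable_const
      measurable_const)

lemma belowDiagWeight_add_swap (a b : ℝ) : belowDiagWeight a b + belowDiagWeight b a = 2 := by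
  unfold belowDiagWeight
  rcases lt_trichotomy a b with h | h | h
  · simp [h, h.not_gt, h.ne']
  · simp [h, one_add_one_eq_two]
  · simp [h, h.not_gt, h.ne']

lemma belowDiagWeight_anti_left {a a' : ℝ} (h : a ≤ a') (b : ℝ) :
    belowDiagWeight a' b ≤ belowDiagWeight a b := by
  unfold belowDiagWeight
  rcases lt_trichotomy a' b with h1 | h1 | h1
  · simp [h1, h.trans_lt h1]
  · rcases h.lt_or_eq with h2 | h2
    · simp [h1, h2.trans_eq h1]
    · simp [h1, h2]
  · simp [h1.not_gt, h1.ne']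

lemma two_mul_indicator_mul_indicator_le {E : Type*} (A : Set E) (N : E → ℝ) (x y : E) :
    2 * (A.indicator (fun _ => (1 : ℝ≥0∞)) x * A.indicator (fun _ => (1 : ℝ≥0∞)) y) ≤
      A.indicator (fun _ => (1 : ℝ≥0∞)) y * belowDiagWeight (N x) (N y) +
      A.indicator (fun _ => (1 : ℝ≥0∞)) x * belowDiagWeight (N y) (N x) := by
  by_cases hx : x ∈ A <;> by_cases hy : y ∈ A <;> simp [hx, hy, belowDiagWeight_add_swap]

section Field

variable {K : Type*} [NormedField K] [MeasurableSpace K] [BorelSpace K]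
  {μ : Measure K} [μ.IsAddLeftInvariant] {h : ℝ → ℝ≥0∞} {C : ℝ≥0∞}

lemma lintegral_comp_norm_affine (μ : Measure K) [μ.IsAddLeftInvariant] (h : ℝ → ℝ≥0∞)
    (a : K) {c : K} (hc : c ≠ 0) :
    ∫⁻ b, h ‖a - b * c‖ ∂μ = ∫⁻ w, h (‖w‖ * ‖c‖) ∂μ := by
  rw [← lintegral_sub_right_eq_self (fun w => h (‖w‖ * ‖c‖)) (a / c)]
  refine lintegral_congr fun b => ?_
  rw [← norm_mul, sub_mul, div_mul_cancel₀ _ hc, norm_sub_rev]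

/-- The case where the first coordinate is not smaller than the second one. -/
lemma lintegral_weight_mul_comp_norm_det_le_aux [SecondCountableTopology K]
    (hh : Measurable h) {y₀ : K} (hy₀ : y₀ ≠ 0)
    (H : (∫⁻ x, belowDiagWeight ‖x‖ ‖y₀‖ ∂μ) * (∫⁻ w, h (‖w‖ * ‖y₀‖) ∂μ) ≤ C) (y₁ : K) :
    ∫⁻ a, ∫⁻ b, belowDiagWeight ‖a‖ ‖y₀‖ * h ‖a * y₁ - b * y₀‖ ∂μ ∂μ ≤ C := by
  refine le_trans (le_of_eq ?_) H
  have hm : Measurable fun a : K => belowDiagWeight ‖a‖ ‖y₀‖ :=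
    measurable_belowDiagWeight.comp (by fun_prop : Measurable fun a : K => (‖a‖, ‖y₀‖))
  rw [← lintegral_mul_const _ hm]
  refine lintegral_congr fun a => ?_
  rw [lintegral_const_mul _ (by fun_prop), lintegral_comp_norm_affine μ h _ hy₀]

variable [SecondCountableTopology K] [SigmaFinite μ]

lemma lintegral_weight_mul_comp_norm_det_le (hh : Measurable h) (h0 : h 0 = 0)
    (H : ∀ y : K, y ≠ 0 →
      (∫⁻ x, belowDiagWeight ‖x‖ ‖y‖ ∂μ) * (∫⁻ w, h (‖w‖ * ‖y‖) ∂μ) ≤ C) (y : Fin 2 → K) :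
    ∫⁻ x, belowDiagWeight ‖x‖ ‖y‖ * h ‖x 0 * y 1 - x 1 * y 0‖ ∂(Measure.pi fun _ : Fin 2 => μ)
      ≤ C := by
  by_cases hy : y = 0
  · simp [hy, h0]
  have hn (i : Fin 2) (x : Fin 2 → K) : ‖x i‖ ≤ ‖x‖ := norm_le_pi_norm x i
  have hm (c : K) : Measurable fun a : K => belowDiagWeight ‖a‖ ‖c‖ :=
    measurable_belowDiagWeight.comp (by fun_prop : Measurable fun a : K => (‖a‖, ‖c‖))
  have tr (f : K → K → ℝ≥0∞) : ∫⁻ x, f (x 0) (x 1) ∂(Measure.pi fun _ : Fin 2 => μ) =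
      ∫⁻ z, f z.1 z.2 ∂(μ.prod μ) :=
    (measurePreserving_finTwoArrow μ).lintegral_comp_emb
      MeasurableEquiv.finTwoArrow.measurableEmbedding (fun z : K × K => f z.1 z.2)
  have hmax : ‖y‖ = ‖y 0‖ ∨ ‖y‖ = ‖y 1‖ := by
    rcases le_total ‖y 1‖ ‖y 0‖ with h1 | h1
    · refine Or.inl (le_antisymm ((pi_norm_le_iff_of_nonneg (norm_nonneg _)).2 ?_) (hn _ _))
      simp [Fin.forall_fin_two, h1]
    · refine Or.inr (le_antisymm ((pi_norm_le_iff_of_nonneg (norm_nonneg _)).2 ?_) (hn _ _))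
      simp [Fin.forall_fin_two, h1]
  rcases hmax with h1 | h1
  · have hy0 : y 0 ≠ 0 := by rwa [← norm_ne_zero_iff, ← h1, norm_ne_zero_iff]
    refine le_trans (lintegral_mono fun x => mul_le_mul_left
      (belowDiagWeight_anti_left (hn 0 x) _) _) ?_
    rw [h1, tr fun a b => belowDiagWeight ‖a‖ ‖y 0‖ * h ‖a * y 1 - b * y 0‖, lintegral_prod]
    · exact lintegral_weight_mul_comp_norm_det_le_aux hh hy0 (H _ hy0) _
    · exact (((hm (y 0)).comp measurable_fst).mul (hh.comp (by fun_prop))).aemeasurable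
  · have hy1 : y 1 ≠ 0 := by rwa [← norm_ne_zero_iff, ← h1, norm_ne_zero_iff]
    refine le_trans (lintegral_mono fun x => mul_le_mul_left
      (belowDiagWeight_anti_left (hn 1 x) _) _) ?_
    rw [h1, tr fun a b => belowDiagWeight ‖b‖ ‖y 1‖ * h ‖a * y 1 - b * y 0‖, lintegral_prod_symm]
    · simp_rw [norm_sub_rev (_ * y 1)]
      exact lintegral_weight_mul_comp_norm_det_le_aux hh hy1 (H _ hy1) _
    · exact (((hm (y 1)).comp measurable_snd).mul (hh.comp (by fun_prop))).aemeasurable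

/-- A bilinear form with kernel `h ‖det (x, y)‖` is controlled on indicators of sets by its
restriction to the pairs with `‖x‖ ≤ ‖y‖`. -/
theorem lintegral_indicator_mul_comp_norm_det_le (hh : Measurable h) (h0 : h 0 = 0)
    (H : ∀ y : K, y ≠ 0 →
      (∫⁻ x, belowDiagWeight ‖x‖ ‖y‖ ∂μ) * (∫⁻ w, h (‖w‖ * ‖y‖) ∂μ) ≤ C)
    {A : Set (Fin 2 → K)} (hA : MeasurableSet A) :
    ∫⁻ x, ∫⁻ y, A.indicator (fun _ => (1 : ℝ≥0∞)) x * A.indicator (fun _ => (1 : ℝ≥0∞)) y *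
        h ‖x 0 * y 1 - x 1 * y 0‖ ∂(Measure.pi fun _ : Fin 2 => μ)
        ∂(Measure.pi fun _ : Fin 2 => μ) ≤
      C * (Measure.pi fun _ : Fin 2 => μ) A := by
  set ν := Measure.pi fun _ : Fin 2 => μ
  have hw : Measurable fun z : (Fin 2 → K) × (Fin 2 → K) => belowDiagWeight ‖z.1‖ ‖z.2‖ :=
    measurable_belowDiagWeight.comp
      (by fun_prop : Measurable fun z : (Fin 2 → K) × (Fin 2 → K) => (‖z.1‖, ‖z.2‖))
  have hi : Measurable (A.indicator fun _ => (1 : ℝ≥0∞)) := measurable_const.indicator hA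
  have hd : Measurable fun z : (Fin 2 → K) × (Fin 2 → K) =>
      h ‖z.1 0 * z.2 1 - z.1 1 * z.2 0‖ := by fun_prop
  have hwl (y : Fin 2 → K) : Measurable fun x : Fin 2 → K => belowDiagWeight ‖x‖ ‖y‖ :=
    hw.comp (by fun_prop : Measurable fun x : Fin 2 → K => (x, y))
  have key (x : Fin 2 → K) : ∫⁻ y, A.indicator (fun _ => (1 : ℝ≥0∞)) x *
      belowDiagWeight ‖y‖ ‖x‖ * h ‖x 0 * y 1 - x 1 * y 0‖ ∂ν ≤
      C * A.indicator (fun _ => (1 : ℝ≥0∞)) x := by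
    have e (y : Fin 2 → K) : ‖x 0 * y 1 - x 1 * y 0‖ = ‖y 0 * x 1 - y 1 * x 0‖ := by
      rw [norm_sub_rev]; ring_nf
    simp_rw [mul_assoc, e]
    rw [lintegral_const_mul _ (by have := hwl x; fun_prop), mul_comm]
    gcongr
    exact lintegral_weight_mul_comp_norm_det_le hh h0 H x
  have tot : ∫⁻ x, C * A.indicator (fun _ => (1 : ℝ≥0∞)) x ∂ν = C * ν A := by
    rw [lintegral_const_mul _ hi, lintegral_indicator_const hA, one_mul]
  refine (ENNReal.mul_le_mul_iff_right (a := 2) (by simp) (by simp)).1 ?_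
  rw [← lintegral_const_mul' _ _ (by simp)]
  simp_rw [← lintegral_const_mul' 2 _ (by simp)]
  calc _ ≤ ∫⁻ x, ∫⁻ y, (A.indicator (fun _ => (1 : ℝ≥0∞)) y * belowDiagWeight ‖x‖ ‖y‖ *
          h ‖x 0 * y 1 - x 1 * y 0‖ + A.indicator (fun _ => (1 : ℝ≥0∞)) x *
          belowDiagWeight ‖y‖ ‖x‖ * h ‖x 0 * y 1 - x 1 * y 0‖) ∂ν ∂ν := by
        refine lintegral_mono fun x => lintegral_mono fun y => ?_
        dsimp only
        rw [← add_mul, ← mul_assoc]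
        gcongr
        exact two_mul_indicator_mul_indicator_le A norm x y
    _ = (∫⁻ x, ∫⁻ y, A.indicator (fun _ => (1 : ℝ≥0∞)) y * belowDiagWeight ‖x‖ ‖y‖ *
          h ‖x 0 * y 1 - x 1 * y 0‖ ∂ν ∂ν) + ∫⁻ x, ∫⁻ y, A.indicator (fun _ => (1 : ℝ≥0∞)) x *
          belowDiagWeight ‖y‖ ‖x‖ * h ‖x 0 * y 1 - x 1 * y 0‖ ∂ν ∂ν := by
        rw [← lintegral_add_right]
        · refine lintegral_congr fun x => lintegral_add_right _ ?_
          have := hwl x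
          fun_prop
        · exact (((hi.comp measurable_fst).mul (hw.comp measurable_swap)).mul
            hd).lintegral_prod_right'
    _ ≤ C * ν A + C * ν A := by
        gcongr
        · rw [lintegral_lintegral_swap (((hi.comp measurable_snd).mul hw).mul hd).aemeasurable,
            ← tot]
          refine lintegral_mono fun y => ?_
          simp_rw [mul_assoc]
          rw [lintegral_const_mul _ (by have := hwl y; fun_prop), mul_comm]
          gcongr
          exact lintegral_weight_mul_comp_norm_det_le hh h0 H y
        · rw [← tot]
          exact lintegral_mono key
    _ = 2 * (C * ν A) := (two_mul _).symm

end Field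

section Real

variable {h : ℝ → ℝ≥0∞}

lemma lintegral_comp_abs_mul (hh : Measurable h) {c : ℝ} (hc : 0 < c) :
    ENNReal.ofReal c * ∫⁻ w : ℝ, h (|w| * c) = 2 * ∫⁻ t in Set.Ioi 0, h t := by
  have h1 : ∫⁻ w : ℝ, h |w| = ENNReal.ofReal c * ∫⁻ w : ℝ, h (|w| * c) := by
    conv_lhs => rw [← Real.smul_map_volume_mul_right hc.ne']
    rw [lintegral_smul_measure, lintegral_map (by fun_prop) (by fun_prop), abs_of_pos hc]
    simp_rw [abs_mul, abs_of_pos hc, smul_eq_mul]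
  have h2 : ∫⁻ t in Set.Ioi 0, h |t| = ∫⁻ t in Set.Ioi 0, h t :=
    setLIntegral_congr_fun measurableSet_Ioi fun t ht => by
      simp only [abs_of_pos (Set.mem_Ioi.1 ht)]
  have h3 : ∫⁻ t in Set.Iio 0, h |t| = ∫⁻ t in Set.Ioi 0, h |t| := by
    have := (Measure.measurePreserving_neg (volume : Measure ℝ)).setLIntegral_comp_preimage
      (measurableSet_Ioi (a := (0 : ℝ))) (f := fun t => h |t|) (by fun_prop)
    simpa using this
  rw [← h1, ← lintegral_add_compl _ (measurableSet_Ioi (a := (0 : ℝ))), Set.compl_Ioi,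
    setLIntegral_congr Iio_ae_eq_Iic.symm, h3, h2, two_mul]

lemma lintegral_belowDiagWeight_real_le (c : ℝ) :
    ∫⁻ x : ℝ, belowDiagWeight |x| c ≤ 4 * ENNReal.ofReal c := by
  calc ∫⁻ x : ℝ, belowDiagWeight |x| c
      ≤ ∫⁻ x : ℝ, (Set.Icc (-c) c).indicator (fun _ => 2) x := by
        refine lintegral_mono fun x => ?_
        by_cases hx : |x| ≤ c
        · rw [Set.indicator_of_mem (Set.mem_Icc.2 (abs_le.1 hx)), belowDiagWeight]
          split_ifs <;> norm_num
        · simp [belowDiagWeight, not_lt_of_ge (not_le.1 hx).le, (not_le.1 hx).ne']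
    _ = 4 * ENNReal.ofReal c := by
        rw [lintegral_indicator_const measurableSet_Icc, Real.volume_Icc, sub_neg_eq_add,
          ← two_mul, ENNReal.ofReal_mul zero_le_two, ← mul_assoc]
        norm_num

theorem lintegral_indicator_mul_comp_abs_det_le (hh : Measurable h) (h0 : h 0 = 0)
    {A : Set (Fin 2 → ℝ)} (hA : MeasurableSet A) :
    ∫⁻ x, ∫⁻ y, A.indicator (fun _ => (1 : ℝ≥0∞)) x * A.indicator (fun _ => (1 : ℝ≥0∞)) y *
        h |x 0 * y 1 - x 1 * y 0| ≤ 8 * (∫⁻ t in Set.Ioi 0, h t) * volume A := by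
  refine lintegral_indicator_mul_comp_norm_det_le hh h0 (fun y hy => ?_) hA
  have hc : 0 < |y| := abs_pos.2 hy
  calc _ ≤ 4 * ENNReal.ofReal |y| * ∫⁻ w : ℝ, h (|w| * |y|) := by
        gcongr
        · exact lintegral_belowDiagWeight_real_le _
        · exact le_rfl
    _ = _ := by
        rw [mul_assoc, lintegral_comp_abs_mul hh hc, ← mul_assoc]
        norm_num

end Real

section Padic

variable {p : ℕ} [hp : Fact p.Prime]

/-- The Haar measure on `ℚ_[p]` giving `ℤ_[p]` measure one. -/
noncomputable def padicHaar (p : ℕ) [Fact p.Prime] : Measure ℚ_[p] :=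
  Measure.addHaarMeasure ⟨⟨Metric.closedBall 0 1, isCompact_closedBall 0 1⟩,
    ⟨0, mem_interior_iff_mem_nhds.2 (Metric.closedBall_mem_nhds 0 one_pos)⟩⟩

instance : (padicHaar p).IsAddHaarMeasure := by unfold padicHaar; infer_instance

lemma padicHaar_closedBall_one : padicHaar p (Metric.closedBall 0 1) = 1 :=
  Measure.addHaarMeasure_self

lemma Padic.exists_norm_sub_lt_of_norm_le {n : ℤ} {x : ℚ_[p]} (hx : ‖x‖ ≤ (p : ℝ) ^ (n + 1)) :
    ∃ j < p, ‖x - j * (p : ℚ_[p]) ^ (-(n + 1))‖ ≤ (p : ℝ) ^ n := by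
  have hp0 : (p : ℝ) ≠ 0 := by exact_mod_cast hp.out.ne_zero
  have hpq : (p : ℚ_[p]) ≠ 0 := by exact_mod_cast hp.out.ne_zero
  have hz : ‖x * (p : ℚ_[p]) ^ (n + 1)‖ ≤ 1 := by
    rw [norm_mul, Padic.norm_p_zpow]
    calc _ ≤ (p : ℝ) ^ (n + 1) * (p : ℝ) ^ (-(n + 1)) := by gcongr
      _ = 1 := by rw [← zpow_add₀ hp0]; simp
  obtain ⟨j, hj, hm⟩ := PadicInt.exists_mem_range (⟨_, hz⟩ : ℤ_[p])
  refine ⟨j, hj, ?_⟩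
  have hm' : ‖x * (p : ℚ_[p]) ^ (n + 1) - j‖ < 1 := by
    rwa [IsLocalRing.mem_maximalIdeal, PadicInt.mem_nonunits, PadicInt.norm_def] at hm
  have hle : ‖x * (p : ℚ_[p]) ^ (n + 1) - j‖ ≤ (p : ℝ) ^ (-1 : ℤ) := by
    rw [Padic.norm_le_pow_iff_norm_lt_pow_add_one]; simpa using hm'
  have e : x - j * (p : ℚ_[p]) ^ (-(n + 1)) =
      (x * (p : ℚ_[p]) ^ (n + 1) - j) * (p : ℚ_[p]) ^ (-(n + 1)) := by
    rw [sub_mul, mul_assoc, ← zpow_add₀ hpq]; simp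
  rw [e, norm_mul, Padic.norm_p_zpow, neg_neg]
  calc _ ≤ (p : ℝ) ^ (-1 : ℤ) * (p : ℝ) ^ (n + 1) := by gcongr
    _ = (p : ℝ) ^ n := by rw [← zpow_add₀ hp0]; congr 1; ring

lemma Padic.closedBall_eq_iUnion (n : ℤ) :
    Metric.closedBall (0 : ℚ_[p]) ((p : ℝ) ^ (n + 1)) =
      ⋃ j : Fin p, Metric.closedBall ((j : ℕ) * (p : ℚ_[p]) ^ (-(n + 1))) ((p : ℝ) ^ n) := by
  have hp1 : (1 : ℝ) ≤ p := by exact_mod_cast hp.out.one_lt.le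
  ext x
  rw [mem_closedBall_zero_iff]
  simp only [Set.mem_iUnion, mem_closedBall_iff_norm]
  refine ⟨fun hx => ?_, fun ⟨j, hj⟩ => ?_⟩
  · obtain ⟨j, hj, h⟩ := Padic.exists_norm_sub_lt_of_norm_le hx
    exact ⟨⟨j, hj⟩, h⟩
  · rw [← sub_add_cancel x ((j : ℕ) * (p : ℚ_[p]) ^ (-(n + 1)))]
    refine (Padic.nonarchimedean _ _).trans (max_le (hj.trans ?_) ?_)
    · exact zpow_le_zpow_right₀ hp1 (by lia)
    · rw [norm_mul, Padic.norm_p_zpow, neg_neg]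
      refine mul_le_of_le_one_left (by positivity) ?_
      exact_mod_cast Padic.norm_int_le_one (p := p) (j : ℕ)

lemma Padic.pairwise_disjoint_closedBall (n : ℤ) :
    Pairwise (Function.onFun Disjoint fun j : Fin p =>
      Metric.closedBall ((j : ℕ) * (p : ℚ_[p]) ^ (-(n + 1))) ((p : ℝ) ^ n)) := by
  have hp1 : (1 : ℝ) < p := by exact_mod_cast hp.out.one_lt
  intro i j hij
  refine Set.disjoint_left.2 fun x hi hj => ?_
  rw [mem_closedBall_iff_norm] at hi hj
  have hd : ‖((i : ℕ) - (j : ℕ) : ℚ_[p]) * (p : ℚ_[p]) ^ (-(n + 1))‖ ≤ (p : ℝ) ^ n := by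
    have e : ((i : ℕ) - (j : ℕ) : ℚ_[p]) * (p : ℚ_[p]) ^ (-(n + 1)) =
      (x - (j : ℕ) * (p : ℚ_[p]) ^ (-(n + 1))) - (x - (i : ℕ) * (p : ℚ_[p]) ^ (-(n + 1))) := by
      ring
    rw [e, sub_eq_add_neg]
    refine (Padic.nonarchimedean _ _).trans (max_le hj ?_)
    rwa [norm_neg]
  have h1 : ‖(((i : ℤ) - (j : ℤ) : ℤ) : ℚ_[p])‖ = 1 := by
    refine le_antisymm (Padic.norm_int_le_one _) (not_lt.1 fun h => ?_)
    rw [Padic.norm_intCast_lt_one_iff] at h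
    refine hij (Fin.ext ?_)
    have := Int.eq_zero_of_abs_lt_dvd h (by have := i.2; have := j.2; rw [abs_lt]; omega)
    omega
  rw [norm_mul, Padic.norm_p_zpow, neg_neg] at hd
  push_cast at h1
  rw [h1, one_mul] at hd
  exact absurd hd (not_le.2 (zpow_lt_zpow_right₀ hp1 (by lia)))

lemma padicHaar_closedBall_succ (n : ℤ) :
    padicHaar p (Metric.closedBall 0 ((p : ℝ) ^ (n + 1))) =
      p * padicHaar p (Metric.closedBall 0 ((p : ℝ) ^ n)) := by
  rw [Padic.closedBall_eq_iUnion, measure_iUnion (Padic.pairwise_disjoint_closedBall n)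
    fun _ => Metric.isClosed_closedBall.measurableSet]
  simp [Measure.addHaar_closedBall_center, tsum_fintype]

lemma padicHaar_closedBall (n : ℤ) :
    padicHaar p (Metric.closedBall 0 ((p : ℝ) ^ n)) = ENNReal.ofReal ((p : ℝ) ^ n) := by
  have hp0 : 0 < (p : ℝ) := by exact_mod_cast hp.out.pos
  have hs (m : ℤ) : ENNReal.ofReal ((p : ℝ) ^ (m + 1)) = p * ENNReal.ofReal ((p : ℝ) ^ m) := by
    rw [zpow_add_one₀ hp0.ne', mul_comm, ENNReal.ofReal_mul hp0.le, ENNReal.ofReal_natCast]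
  induction n with
  | zero => simp [padicHaar_closedBall_one]
  | succ n ih => rw [padicHaar_closedBall_succ, ih, hs]
  | pred n ih =>
    have h1 := padicHaar_closedBall_succ (p := p) (-(n : ℤ) - 1)
    have h2 := hs (-(n : ℤ) - 1)
    rw [sub_add_cancel] at h1 h2
    rw [ih, h2] at h1
    exact ((ENNReal.mul_right_inj (by exact_mod_cast hp.out.ne_zero) (by simp)).1 h1).symm

lemma padicHaar_norm_lt (n : ℤ) :
    padicHaar p {x | ‖x‖ < (p : ℝ) ^ n} = ENNReal.ofReal ((p : ℝ) ^ n * (p : ℝ)⁻¹) := by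
  have hp0 : 0 < (p : ℝ) := by exact_mod_cast hp.out.pos
  rw [← zpow_sub_one₀ hp0.ne', ← padicHaar_closedBall]
  congr 1
  ext x
  simp [Padic.norm_le_pow_iff_norm_lt_pow_add_one]

lemma padicHaar_norm_eq (n : ℤ) :
    padicHaar p {x | ‖x‖ = (p : ℝ) ^ n} = ENNReal.ofReal ((p : ℝ) ^ n * (1 - (p : ℝ)⁻¹)) := by
  have hp0 : 0 < (p : ℝ) := by exact_mod_cast hp.out.pos
  have e : {x : ℚ_[p] | ‖x‖ = (p : ℝ) ^ n} =
      Metric.closedBall 0 ((p : ℝ) ^ n) \ {x | ‖x‖ < (p : ℝ) ^ n} := by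
    ext x
    simp [le_antisymm_iff]
  rw [e, measure_sdiff (fun x hx => by simpa using le_of_lt hx)
    (measurableSet_lt measurable_norm measurable_const).nullMeasurableSet
    (by simp [padicHaar_norm_lt]), padicHaar_closedBall, padicHaar_norm_lt,
    ← ENNReal.ofReal_sub _ (by positivity)]
  ring_nf

lemma lintegral_belowDiagWeight_padic (n : ℤ) :
    ∫⁻ x, belowDiagWeight ‖x‖ ((p : ℝ) ^ n) ∂padicHaar p =
      ENNReal.ofReal ((p : ℝ) ^ n * (1 + (p : ℝ)⁻¹)) := by
  have hp1 : (p : ℝ)⁻¹ ≤ 1 := inv_le_one_of_one_le₀ (by exact_mod_cast hp.out.one_lt.le)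
  have hlt : MeasurableSet {x : ℚ_[p] | ‖x‖ < (p : ℝ) ^ n} :=
    measurableSet_lt measurable_norm measurable_const
  have heq : MeasurableSet {x : ℚ_[p] | ‖x‖ = (p : ℝ) ^ n} :=
    measurableSet_eq_fun measurable_norm measurable_const
  have e (x : ℚ_[p]) : belowDiagWeight ‖x‖ ((p : ℝ) ^ n) =
      {x : ℚ_[p] | ‖x‖ < (p : ℝ) ^ n}.indicator (fun _ => 2) x +
      {x : ℚ_[p] | ‖x‖ = (p : ℝ) ^ n}.indicator (fun _ => 1) x := by
    rcases lt_trichotomy ‖x‖ ((p : ℝ) ^ n) with h | h | h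
    · simp [belowDiagWeight, h, h.ne]
    · simp [belowDiagWeight, h]
    · simp [belowDiagWeight, h.not_gt, h.ne']
  simp_rw [e]
  rw [lintegral_add_left (measurable_const.indicator hlt), lintegral_indicator_const hlt,
    lintegral_indicator_const heq, padicHaar_norm_lt, padicHaar_norm_eq, one_mul,
    ← ENNReal.ofReal_ofNat 2, ← ENNReal.ofReal_mul zero_le_two,
    ← ENNReal.ofReal_add (by positivity) (mul_nonneg (by positivity) (sub_nonneg.2 hp1))]
  ring_nf

theorem lintegral_indicator_mul_padic_det_le (k : ℤ) {A : Set (Fin 2 → ℚ_[p])}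
    (hA : MeasurableSet A) :
    ∫⁻ x, ∫⁻ y, A.indicator (fun _ => (1 : ℝ≥0∞)) x * A.indicator (fun _ => (1 : ℝ≥0∞)) y *
        ({(p : ℝ) ^ k} : Set ℝ).indicator (fun _ => (1 : ℝ≥0∞)) ‖x 0 * y 1 - x 1 * y 0‖
        ∂(Measure.pi fun _ : Fin 2 => padicHaar p) ∂(Measure.pi fun _ : Fin 2 => padicHaar p) ≤
      ENNReal.ofReal ((p : ℝ) ^ k * (1 - ((p : ℝ) ^ 2)⁻¹)) *
        (Measure.pi fun _ : Fin 2 => padicHaar p) A := by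
  have hp0 : 0 < (p : ℝ) := by exact_mod_cast hp.out.pos
  refine lintegral_indicator_mul_comp_norm_det_le
    (measurable_const.indicator (measurableSet_singleton _)) 
    (Set.indicator_of_notMem (by simpa using (zpow_pos hp0 k).ne) _)
    (fun y hy => le_of_eq ?_) hA
  rw [Padic.norm_eq_zpow_neg_valuation hy, lintegral_belowDiagWeight_padic]
  set j := -y.valuation
  have e (w : ℚ_[p]) : ({(p : ℝ) ^ k} : Set ℝ).indicator (fun _ => (1 : ℝ≥0∞))
      (‖w‖ * (p : ℝ) ^ j) = {w : ℚ_[p] | ‖w‖ = (p : ℝ) ^ (k - j)}.indicator (fun _ => 1) w := by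
    simp [Set.indicator_apply, zpow_sub₀ hp0.ne', eq_div_iff (zpow_pos hp0 j).ne']
  simp_rw [e]
  rw [lintegral_indicator_const (measurableSet_eq_fun measurable_norm measurable_const),
    padicHaar_norm_eq, one_mul, ← ENNReal.ofReal_mul (by positivity)]
  congr 1
  rw [zpow_sub₀ hp0.ne']
  field_simp
  ring

end Padic

section Product

lemma lintegral_fin_prod_eq_prod {n : ℕ} {E : Fin n → Type*} {mE : ∀ i, MeasurableSpace (E i)}
    {μ : (i : Fin n) → Measure (E i)} [∀ i, SigmaFinite (μ i)] {f : (i : Fin n) → E i → ℝ≥0∞}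
    (hf : ∀ i, Measurable (f i)) :
    ∫⁻ x, ∏ i, f i (x i) ∂(Measure.pi μ) = ∏ i, ∫⁻ x, f i x ∂(μ i) := by
  induction n with
  | zero => simp
  | succ n ih =>
    have e : ∫⁻ x, ∏ i, f i (x i) ∂(Measure.pi μ) =
        ∫⁻ x : E 0 × ((i : Fin n) → E i.succ), f 0 x.1 * ∏ i : Fin n, f i.succ (x.2 i)
          ∂((μ 0).prod (Measure.pi fun i => μ i.succ)) :=
      Eq.trans (lintegral_congr fun x => Fin.prod_univ_succ _)
        ((measurePreserving_piFinSuccAbove μ 0).lintegral_comp_emb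
          (MeasurableEquiv.measurableEmbedding _) (fun x : E 0 × ((i : Fin n) → E i.succ) =>
            f 0 x.1 * ∏ i : Fin n, f i.succ (x.2 i)))
    rw [e, lintegral_prod_mul (g := fun x : (i : Fin n) → E i.succ => ∏ i, f i.succ (x i))
      (hf 0).aemeasurable, ih fun i => hf i.succ, Fin.prod_univ_succ]
    exact (Finset.measurable_prod _ fun i _ =>
      (hf i.succ).comp (measurable_pi_apply i)).aemeasurable

/-- Factorisation of the double integral of a product kernel over a product space. -/
lemma lintegral_lintegral_prod_pi_eq {n : ℕ} {X : Type*} {E : Fin n → Type*}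
    [MeasurableSpace X] {mE : ∀ i, MeasurableSpace (E i)} {ν : Measure X} [SigmaFinite ν]
    {μ : (i : Fin n) → Measure (E i)} [∀ i, SigmaFinite (μ i)] {g : X → X → ℝ≥0∞}
    {f : (i : Fin n) → E i → E i → ℝ≥0∞} (hg : Measurable (Function.uncurry g))
    (hf : ∀ i, Measurable (Function.uncurry (f i))) :
    ∫⁻ z : (X × ((i : Fin n) → E i)) × (X × ((i : Fin n) → E i)),
        g z.1.1 z.2.1 * ∏ i, f i (z.1.2 i) (z.2.2 i)
        ∂((ν.prod (Measure.pi μ)).prod (ν.prod (Measure.pi μ))) =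
      (∫⁻ x, ∫⁻ y, g x y ∂ν ∂ν) * ∏ i, ∫⁻ x, ∫⁻ y, f i x y ∂(μ i) ∂(μ i) := by
  have hg' (x : X) : Measurable (g x) := hg.of_uncurry_left
  have hf' (i : Fin n) (x : E i) : Measurable (f i x) := (hf i).of_uncurry_left
  have hm : Measurable fun z : (X × ((i : Fin n) → E i)) × (X × ((i : Fin n) → E i)) =>
      g z.1.1 z.2.1 * ∏ i, f i (z.1.2 i) (z.2.2 i) :=
    (hg.comp (by fun_prop : Measurable fun z : (X × ((i : Fin n) → E i)) ×
      (X × ((i : Fin n) → E i)) => (z.1.1, z.2.1))).mul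
      (Finset.measurable_prod _ fun i _ => (hf i).comp (by fun_prop : Measurable fun z :
        (X × ((i : Fin n) → E i)) × (X × ((i : Fin n) → E i)) => (z.1.2 i, z.2.2 i)))
  rw [lintegral_prod _ hm.aemeasurable]
  have inner (x : X × ((i : Fin n) → E i)) :
      ∫⁻ y : X × ((i : Fin n) → E i), g x.1 y.1 * ∏ i, f i (x.2 i) (y.2 i)
        ∂(ν.prod (Measure.pi μ)) =
      (∫⁻ y, g x.1 y ∂ν) * ∏ i, ∫⁻ y, f i (x.2 i) y ∂(μ i) := by
    rw [lintegral_prod_mul (g := fun y : (i : Fin n) → E i => ∏ i, f i (x.2 i) (y i))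
      (hg' x.1).aemeasurable, lintegral_fin_prod_eq_prod fun i => hf' i (x.2 i)]
    exact (Finset.measurable_prod _ fun i _ =>
      (hf' i (x.2 i)).comp (measurable_pi_apply i)).aemeasurable
  simp_rw [inner]
  have hfm (i : Fin n) : Measurable fun x : E i => ∫⁻ y, f i x y ∂(μ i) :=
    (hf i).lintegral_prod_right'
  rw [lintegral_prod_mul (f := fun x => ∫⁻ y, g x y ∂ν)
    (g := fun x : (i : Fin n) → E i => ∏ i, ∫⁻ y, f i (x i) y ∂(μ i))
    hg.lintegral_prod_right'.aemeasurable, lintegral_fin_prod_eq_prod hfm]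
  exact (Finset.measurable_prod _ fun i _ =>
      (hfm i).comp (measurable_pi_apply i)).aemeasurable

end Product

namespace PrimeTup

lemma IsVolS.eq_prod {S : PrimeTup} {d : ℕ} {v : Measure (S.QS d)} (hv : S.IsVolS d v) :
    v = (volume : Measure (Fin d → ℝ)).prod
      (Measure.pi fun i => Measure.pi fun _ : Fin d => padicHaar (S.p i)) := by
  obtain ⟨hv1, -, hv3⟩ := hv
  set m : Measure (S.QS d) := (volume : Measure (Fin d → ℝ)).prod
      (Measure.pi fun i => Measure.pi fun _ : Fin d => padicHaar (S.p i)) with hm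
  have : m.IsAddHaarMeasure := by
    have (i : Fin S.s) :
        (Measure.pi fun _ : Fin d => padicHaar (S.p i)).IsAddHaarMeasure := inferInstance
    have : SFinite (Measure.pi fun i => Measure.pi fun _ : Fin d => padicHaar (S.p i)) :=
      inferInstance
    exact Measure.prod.instIsAddHaarMeasure _ _
  have hbox : m (S.unitBox d) = 1 := by
    have e : S.unitBox d = (Set.univ.pi fun _ => Set.Icc (0 : ℝ) 1) ×ˢ
        (Set.univ.pi fun i => Set.univ.pi fun _ => Metric.closedBall (0 : S.Qp i) 1) := by
      ext x
      simp [unitBox, Set.mem_pi, -Set.pi_univ_Icc]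
    rw [e, hm, Measure.prod_prod, volume_pi_pi, Measure.pi_pi]
    simp [Measure.pi_pi, padicHaar_closedBall_one]
  have h := Measure.isAddLeftInvariant_eq_smul v m
  rw [h, Measure.smul_apply, hbox, ENNReal.smul_def, smul_eq_mul, mul_one] at hv3
  rw [h, ENNReal.coe_eq_one.1 hv3, one_smul]

end PrimeTup

section Weight

variable {χ : ℝ → ℝ} {r : ℝ}

lemma measurable_of_antitoneOn_Icc (hr : 1 < r) (hv : ∀ t ∉ Set.Icc (1 : ℝ) r, χ t = 0)
    (ha : AntitoneOn χ (Set.Icc (1 : ℝ) r)) : Measurable χ := by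
  have e : χ = (Set.Icc (1 : ℝ) r).indicator
      (Set.IccExtend hr.le ((Set.Icc 1 r).domRestrict χ)) := by
    ext t
    by_cases ht : t ∈ Set.Icc (1 : ℝ) r
    · rw [Set.indicator_of_mem ht, Set.IccExtend_of_mem _ _ ht, Set.domRestrict_apply]
    · rw [Set.indicator_of_notMem ht, hv t ht]
  have hm : Antitone (Set.IccExtend hr.le ((Set.Icc 1 r).domRestrict χ)) := fun a b hab =>
    ha (Subtype.coe_prop _) (Subtype.coe_prop _) (Set.monotone_projIcc hr.le hab)
  rw [e]
  exact hm.measurable.indicator measurableSet_Icc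

lemma lintegral_Ioi_ofReal_eq (hr : 1 < r) (hn : ∀ t, 0 ≤ χ t)
    (hv : ∀ t ∉ Set.Icc (1 : ℝ) r, χ t = 0) (ha : AntitoneOn χ (Set.Icc (1 : ℝ) r)) :
    ∫⁻ t in Set.Ioi 1, ENNReal.ofReal (χ t) = ENNReal.ofReal (∫ t in (1 : ℝ)..r, χ t) := by
  have hi : IntegrableOn χ (Set.Ioc 1 r) :=
    ((ha.integrableOn_isCompact isCompact_Icc).mono_set Set.Ioc_subset_Icc_self)
  rw [intervalIntegral.integral_of_le hr.le,
    ofReal_integral_eq_lintegral_ofReal hi (Filter.Eventually.of_forall hn),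
    ← Set.Ioc_union_Ioi_eq_Ioi hr.le, lintegral_union measurableSet_Ioi
      (Set.Ioc_disjoint_Ioi le_rfl)]
  have : ∫⁻ t in Set.Ioi r, ENNReal.ofReal (χ t) = 0 := by
    rw [setLIntegral_congr_fun measurableSet_Ioi (g := fun _ => 0), lintegral_zero]
    intro t ht
    simp [hv t fun h => not_lt_of_ge h.2 ht]
  rw [this, add_zero]

/-- Rescaling the weight by `N ≥ 1` loses at least a factor `N` in its integral over `(1, ∞)`. -/
lemma mul_lintegral_indicator_comp_mul_le (hm : Measurable χ) {N : ℝ} (hN : 1 ≤ N) :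
    ENNReal.ofReal N * ∫⁻ t in Set.Ioi (0 : ℝ),
      (Set.Ioi (1 : ℝ)).indicator (fun t => ENNReal.ofReal (χ (t * N))) t ≤
    ∫⁻ t in Set.Ioi 1, ENNReal.ofReal (χ t) := by
  have hN0 : 0 < N := by linarith
  calc _ ≤ ENNReal.ofReal N * ∫⁻ t : ℝ,
        (Set.Ioi N).indicator (fun t => ENNReal.ofReal (χ t)) (t * N) := by
        refine mul_le_mul_right ?_ _
        refine (setLIntegral_le_lintegral (Set.Ioi 0) _).trans (lintegral_mono fun t => le_of_eq ?_)
        simp only [Set.indicator_apply, Set.mem_Ioi, lt_mul_iff_one_lt_left hN0]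
    _ = ∫⁻ t : ℝ, (Set.Ioi N).indicator (fun t => ENNReal.ofReal (χ t)) t := by
        have hmi : Measurable ((Set.Ioi N).indicator (fun t => ENNReal.ofReal (χ t))) :=
          (ENNReal.measurable_ofReal.comp hm).indicator measurableSet_Ioi
        conv_rhs => rw [← Real.smul_map_volume_mul_right hN0.ne']
        rw [lintegral_smul_measure, lintegral_map hmi (by fun_prop), abs_of_pos hN0, smul_eq_mul]
    _ ≤ _ := by
        rw [lintegral_indicator measurableSet_Ioi]
        exact lintegral_mono_set (Set.Ioi_subset_Ioi hN)

end Weight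

/-- A `p`-adic norm in `(1, r]` is `p ^ k` with `1 ≤ k ≤ log_p r`. -/
lemma Padic.exists_norm_eq_pow {p : ℕ} [hp : Fact p.Prime] {r : ℝ} {x : ℚ_[p]} (h1 : 1 < ‖x‖)
    (h2 : ‖x‖ ≤ r) :
    ∃ k ∈ Finset.Icc 1 ⌊Real.log r / Real.log p⌋₊, ‖x‖ = (p : ℝ) ^ k := by
  have hp1 : (1 : ℝ) < p := by exact_mod_cast hp.out.one_lt
  have hx : x ≠ 0 := by rintro rfl; simp at h1; linarith
  have hv := Padic.norm_eq_zpow_neg_valuation hx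
  have hpos : 0 < -x.valuation := by
    rw [hv] at h1
    exact (one_lt_zpow_iff_right₀ hp1).1 h1
  obtain ⟨k, hk⟩ := Int.eq_ofNat_of_zero_le hpos.le
  rw [hk, zpow_natCast] at hv
  refine ⟨k, Finset.mem_Icc.2 ⟨by lia, Nat.le_floor ?_⟩, hv⟩
  rw [le_div_iff₀ (Real.log_pos hp1), ← Real.log_pow]
  exact Real.log_le_log (by positivity) (hv ▸ h2)

open PrimeTup in
/-- **Determinant-weight inequality over `ℚ_S²`** (Lemma 5.3 (4)).  For a product Borel set
`A = A_∞ × ∏_p A_p ⊆ ℚ_S²` of positive volume, `r > 1`, and `χ : ℝ → [0,∞)` vanishing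
outside `[1, r]` and non-increasing there,
`∬_{|det(x_p,y_p)|_p > 1 ∀p} 1_A(x) 1_A(y) χ(∏_p |det(x_p,y_p)|_p)
  ≤ 8 vol_S(A) [∏_{p∈S_f} (log_p r)(1 − p⁻²)] [χ(1) + ∫₁^r χ]`. -/
theorem determinant_weight_inequality_QS
    (S : PrimeTup)
    (volS : Measure (S.QS 2)) (hvolS : S.IsVolS 2 volS)
    (Ainf : Set (Fin 2 → ℝ)) (hAinf : MeasurableSet Ainf)
    (Ap : (i : Fin S.s) → Set (Fin 2 → S.Qp i)) (hAp : ∀ i, MeasurableSet (Ap i))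
    (A : Set (S.QS 2)) (hA : A = {x | x.1 ∈ Ainf ∧ ∀ i, x.2 i ∈ Ap i})
    (hApos : 0 < volS A)
    (r : ℝ) (hr : 1 < r)
    (χ : ℝ → ℝ)
    (hχ_nonneg : ∀ t, 0 ≤ χ t)
    (hχ_vanish : ∀ t ∉ Set.Icc (1 : ℝ) r, χ t = 0)
    (hχ_anti : AntitoneOn χ (Set.Icc (1 : ℝ) r)) :
    (∫⁻ z in {z : S.QS 2 × S.QS 2 |
          1 < |z.1.1 0 * z.2.1 1 - z.1.1 1 * z.2.1 0| ∧
          ∀ i, 1 < ‖z.1.2 i 0 * z.2.2 i 1 - z.1.2 i 1 * z.2.2 i 0‖},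
        A.indicator (fun _ => (1 : ℝ≥0∞)) z.1 * A.indicator (fun _ => (1 : ℝ≥0∞)) z.2 *
          ENNReal.ofReal (χ (|z.1.1 0 * z.2.1 1 - z.1.1 1 * z.2.1 0| *
            ∏ i, ‖z.1.2 i 0 * z.2.2 i 1 - z.1.2 i 1 * z.2.2 i 0‖))
        ∂(volS.prod volS)) ≤
      ENNReal.ofReal (8 *
          (∏ i, (Real.log r / Real.log (S.p i)) * (1 - ((S.p i : ℝ) ^ 2)⁻¹)) *
          (χ 1 + ∫ t in (1:ℝ)..r, χ t)) * volS A := by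
  subst hA
  have hχm := measurable_of_antitoneOn_Icc hr hχ_vanish hχ_anti
  have hp1 (i : Fin S.s) : (1 : ℝ) < S.p i := by exact_mod_cast (S.hp i).one_lt
  have hp2 (i : Fin S.s) : 0 ≤ 1 - ((S.p i : ℝ) ^ 2)⁻¹ :=
    sub_nonneg.2 (inv_le_one_of_one_le₀ (one_le_pow₀ (hp1 i).le))
  set n : Fin S.s → ℕ := fun i => ⌊Real.log r / Real.log (S.p i)⌋₊
  set T : Finset (Fin S.s → ℕ) := Fintype.piFinset fun i => Finset.Icc 1 (n i) with hT
  set N : (Fin S.s → ℕ) → ℝ := fun k => ∏ i, (S.p i : ℝ) ^ (k i : ℤ) with hN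
  set w : ℝ → ℝ → ℝ≥0∞ := fun M =>
    (Set.Ioi (1 : ℝ)).indicator fun t => ENNReal.ofReal (χ (t * M)) with hw
  set g : ℝ → (Fin 2 → ℝ) → (Fin 2 → ℝ) → ℝ≥0∞ := fun M x y =>
    Ainf.indicator (fun _ => (1 : ℝ≥0∞)) x * Ainf.indicator (fun _ => (1 : ℝ≥0∞)) y *
      w M |x 0 * y 1 - x 1 * y 0| with hg
  set f : (i : Fin S.s) → ℕ → (Fin 2 → S.Qp i) → (Fin 2 → S.Qp i) → ℝ≥0∞ := fun i m x y =>
    (Ap i).indicator (fun _ => (1 : ℝ≥0∞)) x * (Ap i).indicator (fun _ => (1 : ℝ≥0∞)) y *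
      ({(S.p i : ℝ) ^ (m : ℤ)} : Set ℝ).indicator (fun _ => (1 : ℝ≥0∞))
        ‖x 0 * y 1 - x 1 * y 0‖ with hf
  have hwm (M : ℝ) : Measurable (w M) :=
    Measurable.indicator (by fun_prop) measurableSet_Ioi
  have hgm (M : ℝ) : Measurable (Function.uncurry (g M)) := by
    have hi : Measurable (Ainf.indicator fun _ => (1 : ℝ≥0∞)) := measurable_const.indicator hAinf
    exact ((hi.comp measurable_fst).mul (hi.comp measurable_snd)).mul
      ((hwm M).comp (by fun_prop))
  have hfm (i : Fin S.s) (m : ℕ) : Measurable (Function.uncurry (f i m)) := by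
    have hi : Measurable ((Ap i).indicator fun _ => (1 : ℝ≥0∞)) :=
      measurable_const.indicator (hAp i)
    exact ((hi.comp measurable_fst).mul (hi.comp measurable_snd)).mul
      ((measurable_const.indicator (measurableSet_singleton _)).comp (by fun_prop))
  have hFm (k : Fin S.s → ℕ) : Measurable fun z : S.QS 2 × S.QS 2 =>
      g (N k) z.1.1 z.2.1 * ∏ i, f i (k i) (z.1.2 i) (z.2.2 i) :=
    ((hgm (N k)).comp (by fun_prop : Measurable fun z : S.QS 2 × S.QS 2 => (z.1.1, z.2.1))).mul
      (Finset.measurable_prod _ fun i _ => (hfm i (k i)).comp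
        (by fun_prop : Measurable fun z : S.QS 2 × S.QS 2 => (z.1.2 i, z.2.2 i)))
  set J : ℝ≥0∞ := ENNReal.ofReal (∫ t in (1 : ℝ)..r, χ t) with hJ
  set c : ℝ≥0∞ := ∏ i, ENNReal.ofReal (1 - ((S.p i : ℝ) ^ 2)⁻¹) with hc
  set V := volS {x | x.1 ∈ Ainf ∧ ∀ i, x.2 i ∈ Ap i} with hV
  have hVeq : V = volume Ainf *
      ∏ i, (Measure.pi fun _ : Fin 2 => padicHaar (S.p i)) (Ap i) := by
    have e : {x : S.QS 2 | x.1 ∈ Ainf ∧ ∀ i, x.2 i ∈ Ap i} = Ainf ×ˢ Set.univ.pi Ap := by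
      ext x
      simp
    rw [hV, hvolS.eq_prod, e, Measure.prod_prod, Measure.pi_pi]
  have hterm (k : Fin S.s → ℕ) :
      ∫⁻ z : S.QS 2 × S.QS 2, g (N k) z.1.1 z.2.1 * ∏ i, f i (k i) (z.1.2 i) (z.2.2 i)
        ∂(volS.prod volS) ≤ 8 * J * c * V := by
    have hN1 : 1 ≤ N k :=
      Finset.one_le_prod fun i _ => one_le_zpow₀ (hp1 i).le (by positivity)
    rw [hvolS.eq_prod, lintegral_lintegral_prod_pi_eq (hgm _) fun i => hfm i (k i)]
    calc _ ≤ (8 * (∫⁻ t in Set.Ioi 0, w (N k) t) * volume Ainf) *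
          ∏ i, (ENNReal.ofReal ((S.p i : ℝ) ^ (k i : ℤ) * (1 - ((S.p i : ℝ) ^ 2)⁻¹)) *
            (Measure.pi fun _ : Fin 2 => padicHaar (S.p i)) (Ap i)) := by
          refine mul_le_mul' (lintegral_indicator_mul_comp_abs_det_le (hwm _) ?_ hAinf)
            (Finset.prod_le_prod' fun i _ => lintegral_indicator_mul_padic_det_le _ (hAp i))
          simp [hw]
      _ = 8 * (ENNReal.ofReal (N k) * ∫⁻ t in Set.Ioi 0, w (N k) t) * c * V := by
          have e : ENNReal.ofReal (N k) = ∏ i, ENNReal.ofReal ((S.p i : ℝ) ^ (k i : ℤ)) :=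
            ENNReal.ofReal_prod_of_nonneg fun i _ => by positivity
          have e' (i : Fin S.s) :
              ENNReal.ofReal ((S.p i : ℝ) ^ (k i : ℤ) * (1 - ((S.p i : ℝ) ^ 2)⁻¹)) =
              ENNReal.ofReal ((S.p i : ℝ) ^ (k i : ℤ)) *
                ENNReal.ofReal (1 - ((S.p i : ℝ) ^ 2)⁻¹) :=
            ENNReal.ofReal_mul (by positivity)
          simp_rw [e']
          rw [Finset.prod_mul_distrib, Finset.prod_mul_distrib, e, hVeq]
          ring
      _ ≤ 8 * J * c * V := by
          gcongr
          rw [hJ, ← lintegral_Ioi_ofReal_eq hr hχ_nonneg hχ_vanish hχ_anti]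
          exact mul_lintegral_indicator_comp_mul_le hχm hN1
  have hpt : ∀ z ∈ {z : S.QS 2 × S.QS 2 |
          1 < |z.1.1 0 * z.2.1 1 - z.1.1 1 * z.2.1 0| ∧
          ∀ i, 1 < ‖z.1.2 i 0 * z.2.2 i 1 - z.1.2 i 1 * z.2.2 i 0‖},
      {x : S.QS 2 | x.1 ∈ Ainf ∧ ∀ i, x.2 i ∈ Ap i}.indicator (fun _ => (1 : ℝ≥0∞)) z.1 *
        {x : S.QS 2 | x.1 ∈ Ainf ∧ ∀ i, x.2 i ∈ Ap i}.indicator (fun _ => (1 : ℝ≥0∞)) z.2 *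
        ENNReal.ofReal (χ (|z.1.1 0 * z.2.1 1 - z.1.1 1 * z.2.1 0| *
            ∏ i, ‖z.1.2 i 0 * z.2.2 i 1 - z.1.2 i 1 * z.2.2 i 0‖)) ≤
      ∑ k ∈ T, g (N k) z.1.1 z.2.1 * ∏ i, f i (k i) (z.1.2 i) (z.2.2 i) := by
    rintro ⟨x, y⟩ ⟨hz1, hz2⟩
    dsimp only at hz1 hz2 ⊢
    by_cases hx : x ∈ {x : S.QS 2 | x.1 ∈ Ainf ∧ ∀ i, x.2 i ∈ Ap i}
    swap
    · simp [Set.indicator_of_notMem hx]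
    by_cases hy : y ∈ {x : S.QS 2 | x.1 ∈ Ainf ∧ ∀ i, x.2 i ∈ Ap i}
    swap
    · simp [Set.indicator_of_notMem hy]
    rw [Set.indicator_of_mem hx, Set.indicator_of_mem hy, one_mul, one_mul]
    by_cases hle : |x.1 0 * y.1 1 - x.1 1 * y.1 0| *
        ∏ i, ‖x.2 i 0 * y.2 i 1 - x.2 i 1 * y.2 i 0‖ ≤ r
    swap
    · rw [hχ_vanish _ fun h => hle h.2]
      simp
    have hri (i : Fin S.s) : ‖x.2 i 0 * y.2 i 1 - x.2 i 1 * y.2 i 0‖ ≤ r := by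
      refine le_trans ?_ hle
      rw [← Finset.mul_prod_erase _ _ (Finset.mem_univ i), mul_left_comm]
      exact le_mul_of_one_le_right (norm_nonneg _) (one_le_mul_of_one_le_of_one_le hz1.le
        (Finset.one_le_prod fun j _ => (hz2 j).le))
    choose k hk hk' using fun i => Padic.exists_norm_eq_pow (hz2 i) (hri i)
    refine le_trans (le_of_eq ?_) (Finset.single_le_sum (fun _ _ => zero_le)
      (Fintype.mem_piFinset.2 hk : k ∈ T))
    have hf1 (i : Fin S.s) : f i (k i) (x.2 i) (y.2 i) = 1 := by
      simp [hf, hx.2 i, hy.2 i, hk' i]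
    have hg1 : g (N k) x.1 y.1 = ENNReal.ofReal (χ (|x.1 0 * y.1 1 - x.1 1 * y.1 0| * N k)) := by
      simp [hg, hw, hx.1, hy.1, hz1]
    rw [Finset.prod_congr rfl fun i _ => hf1 i, Finset.prod_const_one, mul_one, hg1]
    simp only [hN, zpow_natCast, hk']
  have hcard : (T.card : ℝ≥0∞) ≤ ∏ i, ENNReal.ofReal (Real.log r / Real.log (S.p i)) := by
    rw [hT, Fintype.card_piFinset, Nat.cast_prod]
    refine Finset.prod_le_prod' fun i _ => ?_
    rw [Nat.card_Icc, Nat.add_sub_cancel, ← ENNReal.ofReal_natCast]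
    exact ENNReal.ofReal_le_ofReal (Nat.floor_le
      (div_nonneg (Real.log_nonneg hr.le) (Real.log_nonneg (hp1 i).le)))
  calc _ ≤ ∫⁻ z : S.QS 2 × S.QS 2, ∑ k ∈ T, g (N k) z.1.1 z.2.1 *
        ∏ i, f i (k i) (z.1.2 i) (z.2.2 i) ∂(volS.prod volS) :=
        (setLIntegral_mono (Finset.measurable_sum _ fun k _ => hFm k) hpt).trans
          (setLIntegral_le_lintegral _ _)
    _ ≤ ∑ k ∈ T, 8 * J * c * V := by
        rw [lintegral_finsetSum _ fun k _ => hFm k]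
        exact Finset.sum_le_sum fun k _ => hterm k
    _ = 8 * (T.card * c) * J * V := by
        rw [Finset.sum_const, nsmul_eq_mul]
        ring
    _ ≤ 8 * ((∏ i, ENNReal.ofReal (Real.log r / Real.log (S.p i))) * c) *
          ENNReal.ofReal (χ 1 + ∫ t in (1 : ℝ)..r, χ t) * V := by
        gcongr
        exact ENNReal.ofReal_le_ofReal (by linarith [hχ_nonneg 1])
    _ = _ := by
        rw [hc, ← Finset.prod_mul_distrib]
        simp_rw [← ENNReal.ofReal_mul' (hp2 _)]
        have h0 (i : Fin S.s) :
            0 ≤ Real.log r / Real.log (S.p i) * (1 - ((S.p i : ℝ) ^ 2)⁻¹) :=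
          mul_nonneg (div_nonneg (Real.log_nonneg hr.le) (Real.log_nonneg (hp1 i).le)) (hp2 i)
        rw [← ENNReal.ofReal_prod_of_nonneg fun i _ => h0 i,
          ← ENNReal.ofReal_ofNat 8, ← ENNReal.ofReal_mul (by norm_num),
          ← ENNReal.ofReal_mul (mul_nonneg (by norm_num) (Finset.prod_nonneg fun i _ => h0 i))]
end
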